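/- arXiv:0904.1948 — 3 statements merged into one kernel-verified Lean document; each statement's English description precedes it below -/
import Mathlib

section
/- Let r, s ∈ ℕ. If L(Σ,k⃗;υ) = A₁ ∪ … ∪ A_r and L(Σ,k⃗) = C₁ ∪ … ∪ C_s, then there exist a sequence (wₙ)_{n∈ℕ} in L(Σ,k⃗;υ) with wₙ < wₙ₊₁ for every n ∈ ℕ and indices 1 ≤ i₀ ≤ r, 1 ≤ j₀ ≤ s such that: T_{p₁}(w_{n₁}) ⋆ … ⋆ T_{p_λ}(w_{n_λ}) ∈ A_{i₀} for every λ ∈ ℕ, n₁ < … < n_λ ∈ ℕ and p₁,…,p_λ ∈ ℕ ∪ {0} with 0 ≤ pᵢ ≤ k_{nᵢ} for every 1 ≤ i ≤ λ and 0 ∈ {p₁,…,p_λ}; and T_{p₁}(w_{n₁}) ⋆ … ⋆ T_{p_λ}(w_{n_λ}) ∈ C_{j₀} for every λ ∈ ℕ, n₁ < … < n_λ ∈ ℕ and p₁,…,p_λ ∈ ℕ with 1 ≤ pᵢ ≤ k_{nᵢ} for every 1 ≤ i ≤ λ. -/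
namespace Farmaki

/-- A located word over the alphabet `Σ ∪ {υ}`: positions are natural numbers,
`none` means the position is not in the domain, `some 0` is the variable `υ`,
and `some a` for `a ≥ 1` is the letter `αₐ`. -/
abbrev LWord := ℕ → Option ℕ

/-- The domain of a located word. -/
def dom (w : LWord) : Set ℕ := {n | w n ≠ none}

/-- `min dom(w)`. -/
noncomputable def minDom (w : LWord) : ℕ := sInf (dom w)

/-- A variable ω-located word over `Σ` dominated by `k`. -/
def IsVarWord (k : ℕ → ℕ) (w : LWord) : Prop :=
  (dom w).Finite ∧ (dom w).Nonempty ∧ (∀ n a, w n = some a → a ≤ k n) ∧ ∃ n, w n = some 0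

/-- A (constant) ω-located word over `Σ` dominated by `k`. -/
def IsConstWord (k : ℕ → ℕ) (w : LWord) : Prop :=
  (dom w).Finite ∧ (dom w).Nonempty ∧ ∀ n a, w n = some a → 1 ≤ a ∧ a ≤ k n

/-- `w < u` iff `max dom(w) < min dom(u)`. -/
def wlt (w u : LWord) : Prop := ∀ m n, w m ≠ none → u n ≠ none → m < n

/-- Concatenation `w ⋆ u` of located words (union of graphs, `w` taking precedence). -/
def star (w u : LWord) : LWord := fun n => (w n).orElse (fun _ => u n)

/-- The empty located word. -/
def emptyW : LWord := fun _ => none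

/-- The substitution `T_p`: for `p ≥ 1` it replaces the variable `υ` at position `n`
by `α_p` if `k n ≥ p` and by `α_{k n}` otherwise; `T_0` is the identity. -/
def Tp (k : ℕ → ℕ) (p : ℕ) (w : LWord) : LWord := fun n =>
  match w n with
  | none => none
  | some a => if a = 0 ∧ p ≠ 0 then some (min p (k n)) else some a

/-- The combination `T_{p 0}(w (n 0)) ⋆ ⋯ ⋆ T_{p l}(w (n l))`. -/
def comb (k : ℕ → ℕ) (w : ℕ → LWord) {l : ℕ} (n p : Fin (l + 1) → ℕ) : LWord :=
  (List.ofFn fun i => Tp k (p i) (w (n i))).foldr star emptyW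

/-- `EV(w⃗)`: the extracted variable ω-located words of a sequence `w⃗`. -/
def EV (k : ℕ → ℕ) (w : ℕ → LWord) : Set LWord :=
  {u | ∃ (l : ℕ) (n p : Fin (l + 1) → ℕ), StrictMono n ∧
    (∀ i, p i ≤ k (n i)) ∧ (∃ i, p i = 0) ∧ u = comb k w n p}

/-- `E(w⃗)`: the extracted (constant) ω-located words of a sequence `w⃗`. -/
def Econst (k : ℕ → ℕ) (w : ℕ → LWord) : Set LWord :=
  {u | ∃ (l : ℕ) (n p : Fin (l + 1) → ℕ), StrictMono n ∧
    (∀ i, 1 ≤ p i ∧ p i ≤ k (n i)) ∧ u = comb k w n p}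

/-- An infinite orderly sequence of variable ω-located words, i.e. a member of
`L^∞(Σ,k⃗;υ)`. -/
def OrderlyVar (k : ℕ → ℕ) (w : ℕ → LWord) : Prop :=
  (∀ n, IsVarWord k (w n)) ∧ ∀ n, wlt (w n) (w (n + 1))

/-- `u⃗ ≺ w⃗`: `u⃗` is an extraction of `w⃗`. -/
def Extraction (k : ℕ → ℕ) (u w : ℕ → LWord) : Prop :=
  OrderlyVar k u ∧ ∀ n, u n ∈ EV k w

/-- A finite orderly sequence of variable ω-located words, i.e. a member of
`L^{<∞}(Σ,k⃗;υ)` (the empty list is allowed). -/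
def FinOrderlyV (k : ℕ → ℕ) (ws : List LWord) : Prop :=
  (∀ w ∈ ws, IsVarWord k w) ∧ ws.Chain' wlt

/-- A finite orderly sequence of (constant) ω-located words, i.e. a member of
`L^{<∞}(Σ,k⃗)` (the empty list is allowed). -/
def FinOrderlyC (k : ℕ → ℕ) (ws : List LWord) : Prop :=
  (∀ w ∈ ws, IsConstWord k w) ∧ ws.Chain' wlt

end Farmaki

namespace Farmaki

open Filter

attribute [local instance] Ultrafilter.semigroup

section CompactSemigroup

variable {M : Type*} [Semigroup M] [TopologicalSpace M] [CompactSpace M]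

/-- A nonempty closed subsemigroup of a compact right topological semigroup contains a minimal
closed left ideal. -/
theorem exists_minimal_closed_leftIdeal {K : Set M} (hK : IsClosed K) (hKne : K.Nonempty)
    (hKmul : ∀ x ∈ K, ∀ y ∈ K, x * y ∈ K) :
    ∃ L : Set M, Minimal
      (fun L => IsClosed L ∧ L.Nonempty ∧ L ⊆ K ∧ ∀ x ∈ K, ∀ y ∈ L, x * y ∈ L) L := by
  refine zorn_superset {L | IsClosed L ∧ L.Nonempty ∧ L ⊆ K ∧ ∀ x ∈ K, ∀ y ∈ L, x * y ∈ L}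
    fun c hcs hc => ?_
  obtain rfl | hcne := c.eq_empty_or_nonempty
  · exact ⟨K, ⟨hK, hKne, subset_rfl, hKmul⟩, by simp⟩
  have hcs' : ∀ t ∈ c, IsClosed t ∧ t.Nonempty ∧ t ⊆ K ∧ ∀ x ∈ K, ∀ y ∈ t, x * y ∈ t :=
    fun t ht => hcs ht
  refine ⟨⋂₀ c, ⟨isClosed_sInter fun t ht => (hcs' t ht).1, ?_, ?_, ?_⟩,
    fun s hs => Set.sInter_subset_of_mem hs⟩
  · rw [Set.sInter_eq_iInter]
    have := hcne.coe_sort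
    exact IsCompact.nonempty_iInter_of_directed_nonempty_isCompact_isClosed _
      (DirectedOn.directed_val (IsChain.directedOn hc.symm))
      (fun i => (hcs' i i.prop).2.1) (fun i => (hcs' i i.prop).1.isCompact)
      (fun i => (hcs' i i.prop).1)
  · obtain ⟨t, ht⟩ := hcne
    exact (Set.sInter_subset_of_mem ht).trans (hcs' t ht).2.2.1
  · intro x hx y hy
    rw [Set.mem_sInter] at hy ⊢
    exact fun t ht => (hcs' t ht).2.2.2 x hx y (hy t ht)

variable [T2Space M]

/-- A nonempty closed subsemigroup of a compact right topological semigroup contains an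
idempotent that is minimal for the order `ρ ≤ ν ↔ ρ * ν = ρ ∧ ν * ρ = ρ`. -/
theorem exists_minimal_idempotent (hcont : ∀ x : M, Continuous (· * x)) {K : Set M}
    (hK : IsClosed K) (hKne : K.Nonempty) (hKmul : ∀ x ∈ K, ∀ y ∈ K, x * y ∈ K) :
    ∃ ν ∈ K, ν * ν = ν ∧ ∀ ρ ∈ K, ρ * ρ = ρ → ρ * ν = ρ → ν * ρ = ρ → ρ = ν := by
  obtain ⟨L, hL⟩ := exists_minimal_closed_leftIdeal hK hKne hKmul
  obtain ⟨hLc, hLne, hLK, hLmul⟩ := hL.prop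
  obtain ⟨ν, hνL, hν⟩ := exists_idempotent_in_compact_subsemigroup hcont L hLne hLc.isCompact
    fun x hx y hy => hLmul x (hLK hx) y hy
  refine ⟨ν, hLK hνL, hν, fun ρ hρ hρρ hρν hνρ => ?_⟩
  have hρL : ρ ∈ L := hρν ▸ hLmul ρ hρ ν hνL
  have hsub : L ⊆ (· * ρ) '' K := by
    refine hL.le_of_le ⟨(hcont ρ).isClosedMap _ hK, hKne.image _, ?_, ?_⟩ ?_
    · rintro _ ⟨x, hx, rfl⟩
      exact hKmul x hx ρ hρ
    · rintro x hx _ ⟨y, hy, rfl⟩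
      exact ⟨x * y, hKmul x hx y hy, mul_assoc _ _ _⟩
    · rintro _ ⟨x, hx, rfl⟩
      exact hLmul x hx ρ hρL
  obtain ⟨x, -, hx⟩ := hsub hνL
  have hx' : x * ρ = ν := hx
  rw [← hνρ, ← hx', mul_assoc, hρρ]

/-- Below an idempotent `ν` there is an idempotent in every nonempty closed subsemigroup `V` which
is invariant under multiplication by `ν` on both sides. -/
theorem exists_idempotent_le (hcont : ∀ x : M, Continuous (· * x)) {V : Set M}
    (hV : IsClosed V) (hVne : V.Nonempty) (hVmul : ∀ x ∈ V, ∀ y ∈ V, x * y ∈ V) {ν : M}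
    (hν : ν * ν = ν) (hνV : ∀ x ∈ V, ν * x ∈ V) (hVν : ∀ x ∈ V, x * ν ∈ V) :
    ∃ μ ∈ V, μ * μ = μ ∧ μ * ν = μ ∧ ν * μ = μ := by
  obtain ⟨_, ⟨x, hx, rfl⟩, hidem⟩ := exists_idempotent_in_compact_subsemigroup hcont
    ((· * ν) '' V) (hVne.image _) ((hcont ν).isClosedMap _ hV).isCompact (by
      rintro _ ⟨x, hx, rfl⟩ _ ⟨y, hy, rfl⟩
      exact ⟨x * ν * y, hVmul _ (hVν x hx) y hy, by simp only [mul_assoc]⟩)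
  set m := x * ν with hm
  have hmν : m * ν = m := by rw [hm, mul_assoc, hν]
  have hidem : m * m = m := hidem
  refine ⟨ν * m, hνV _ (hVν x hx), ?_, ?_, ?_⟩
  · rw [mul_assoc, ← mul_assoc m, hmν, hidem]
  · rw [mul_assoc, hmν]
  · rw [← mul_assoc, hν]

end CompactSemigroup

theorem _root_.Ultrafilter.map_mul_of_hom {M N : Type*} [Semigroup M] [Semigroup N] (f : M → N)
    (hf : ∀ x y, f (x * y) = f x * f y) (U V : Ultrafilter M) :
    (U * V).map f = U.map f * V.map f :=
  Ultrafilter.coe_inj.mp <| Filter.ext' fun p => by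
    rw [Ultrafilter.eventually_mul]
    simp only [Ultrafilter.coe_map, eventually_map]
    rw [Ultrafilter.eventually_mul]
    simp only [hf]

/-- Located words form a monoid under concatenation (with precedence for the left factor). -/
instance : Monoid LWord where
  mul := star
  one := emptyW
  mul_assoc u v w := by
    funext n
    change star (star u v) w n = star u (star v w) n
    simp only [star]
    cases u n <;> rfl
  one_mul u := rfl
  mul_one u := by
    funext n
    change star u emptyW n = u n
    simp only [star, emptyW]
    cases u n <;> rfl

theorem mul_apply (u v : LWord) (n : ℕ) : (u * v) n = (u n).orElse fun _ => v n := rfl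

theorem mul_apply_eq_some {u v : LWord} {n a : ℕ} (h : (u * v) n = some a) :
    u n = some a ∨ v n = some a := by
  rw [mul_apply] at h
  cases hu : u n with
  | none => right; simpa [hu] using h
  | some b => left; simpa [hu] using h

theorem dom_mul (u v : LWord) : dom (u * v) = dom u ∪ dom v := by
  ext n
  change (u * v) n ≠ none ↔ u n ≠ none ∨ v n ≠ none
  rw [mul_apply]
  cases u n <;> simp

theorem dom_one : dom (1 : LWord) = ∅ := by
  ext n
  change (none : Option ℕ) ≠ none ↔ False
  simp

section Substitution

variable {k : ℕ → ℕ}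

theorem Tp_mul (p : ℕ) (u v : LWord) : Tp k p (u * v) = Tp k p u * Tp k p v := by
  funext n
  rw [mul_apply]
  simp only [Tp, mul_apply]
  cases u n with
  | none => rfl
  | some a =>
    simp only [Option.orElse_some]
    split <;> rfl

theorem Tp_zero (w : LWord) : Tp k 0 w = w := by
  funext n
  simp only [Tp]
  cases w n <;> simp

theorem dom_Tp (p : ℕ) (w : LWord) : dom (Tp k p w) = dom w := by
  ext n
  change Tp k p w n ≠ none ↔ w n ≠ none
  simp only [Tp]
  cases w n with
  | none => simp
  | some a => simp only; split <;> simp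

theorem Tp_of_isConstWord {w : LWord} (hw : IsConstWord k w) (p : ℕ) : Tp k p w = w := by
  funext n
  simp only [Tp]
  cases h : w n with
  | none => rfl
  | some a =>
    have := (hw.2.2 n a h).1
    simp only
    rw [if_neg (by omega)]

theorem IsVarWord.isConstWord_Tp (hk : ∀ n, 0 < k n) {w : LWord} (hw : IsVarWord k w) {p : ℕ}
    (hp : p ≠ 0) : IsConstWord k (Tp k p w) := by
  refine ⟨by rw [dom_Tp]; exact hw.1, by rw [dom_Tp]; exact hw.2.1, fun n a h => ?_⟩
  simp only [Tp] at h
  cases hwn : w n with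
  | none => simp [hwn] at h
  | some b =>
    have hb := hw.2.2.1 n b hwn
    have hkn := hk n
    simp only [hwn] at h
    split at h <;> simp only [Option.some.injEq] at h <;> omega

theorem IsConstWord.mul {u v : LWord} (hu : IsConstWord k u) (hv : IsConstWord k v) :
    IsConstWord k (u * v) := by
  refine ⟨by rw [dom_mul]; exact hu.1.union hv.1, by rw [dom_mul]; exact hu.2.1.inl, ?_⟩
  intro n a h
  exact (mul_apply_eq_some h).elim (hu.2.2 n a) (hv.2.2 n a)

/-- Words whose letters are dominated by `k`, possibly with variables, possibly empty. -/
def IsWord (k : ℕ → ℕ) (w : LWord) : Prop :=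
  (dom w).Finite ∧ ∀ n a, w n = some a → a ≤ k n

theorem IsVarWord.isWord {w : LWord} (hw : IsVarWord k w) : IsWord k w := ⟨hw.1, hw.2.2.1⟩

theorem IsConstWord.isWord {w : LWord} (hw : IsConstWord k w) : IsWord k w :=
  ⟨hw.1, fun n a h => (hw.2.2 n a h).2⟩

theorem IsVarWord.mul_right {u v : LWord} (hu : IsVarWord k u) (hv : IsWord k v) :
    IsVarWord k (u * v) := by
  obtain ⟨n, hn⟩ := hu.2.2.2
  refine ⟨by rw [dom_mul]; exact hu.1.union hv.1, by rw [dom_mul]; exact hu.2.1.inl, ?_, n, ?_⟩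
  · intro n a h
    exact (mul_apply_eq_some h).elim (hu.2.2.1 n a) (hv.2 n a)
  · rw [mul_apply, hn]; rfl

theorem IsVarWord.mul_left {u v : LWord} (hu : IsWord k u) (hv : IsVarWord k v) (h : wlt u v) :
    IsVarWord k (u * v) := by
  obtain ⟨n, hn⟩ := hv.2.2.2
  refine ⟨by rw [dom_mul]; exact hu.1.union hv.1, by rw [dom_mul]; exact hv.2.1.inr, ?_, n, ?_⟩
  · intro n a h
    exact (mul_apply_eq_some h).elim (hu.2 n a) (hv.2.2.1 n a)
  · have : u n = none := by
      by_contra hne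
      exact lt_irrefl _ (h n n hne (by simp [hn]))
    rw [mul_apply, this]; exact hn

theorem IsWord.mul {u v : LWord} (hu : IsWord k u) (hv : IsWord k v) : IsWord k (u * v) :=
  ⟨by rw [dom_mul]; exact hu.1.union hv.1,
    fun n a h => (mul_apply_eq_some h).elim (hu.2 n a) (hv.2 n a)⟩

theorem IsVarWord.isWord_Tp (hk : ∀ n, 0 < k n) {w : LWord} (hw : IsVarWord k w) (p : ℕ) :
    IsWord k (Tp k p w) := by
  obtain rfl | hp := eq_or_ne p 0
  · rw [Tp_zero]; exact hw.isWord
  · exact (hw.isConstWord_Tp hk hp).isWord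

theorem IsVarWord.not_isConstWord {w : LWord} (hw : IsVarWord k w) : ¬ IsConstWord k w := by
  intro h
  obtain ⟨n, hn⟩ := hw.2.2.2
  exact absurd (h.2.2 n 0 hn).1 (by omega)

end Substitution

/-- The ultrafilters concentrated on words satisfying `P` whose domains escape to infinity. -/
def escaping (P : LWord → Prop) : Set (Ultrafilter LWord) :=
  {U | (∀ᶠ w in U, P w) ∧ ∀ N, ∀ᶠ w in U, ∀ m ∈ dom w, N < m}

theorem isClosed_escaping (P : LWord → Prop) : IsClosed (escaping P) := by
  have : escaping P = {U : Ultrafilter LWord | {w | P w} ∈ U} ∩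
      ⋂ N, {U : Ultrafilter LWord | {w | ∀ m ∈ dom w, N < m} ∈ U} := by
    ext U
    rw [Set.mem_inter_iff, Set.mem_iInter]
    rfl
  rw [this]
  exact (ultrafilter_isClosed_basic _).inter (isClosed_iInter fun N => ultrafilter_isClosed_basic _)

theorem eventually_wlt {P : LWord → Prop} {U : Ultrafilter LWord} (hU : U ∈ escaping P)
    {u : LWord} (hu : (dom u).Finite) : ∀ᶠ w in U, wlt u w := by
  obtain ⟨N, hN⟩ := hu.bddAbove
  filter_upwards [hU.2 N] with w hw m n hm hn
  exact (hN hm).trans_lt (hw n hn)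

theorem mul_mem_escaping {P Q R : LWord → Prop} {U V : Ultrafilter LWord}
    (hU : U ∈ escaping P) (hV : V ∈ escaping Q) (hP : ∀ u, P u → (dom u).Finite)
    (h : ∀ u v, P u → Q v → wlt u v → R (u * v)) : U * V ∈ escaping R := by
  refine ⟨?_, fun N => ?_⟩
  · rw [Ultrafilter.eventually_mul]
    filter_upwards [hU.1] with u hu
    filter_upwards [hV.1, eventually_wlt hV (hP u hu)] with v hv huv using h u v hu hv huv
  · rw [Ultrafilter.eventually_mul]
    filter_upwards [hU.2 N] with u hu
    filter_upwards [hV.2 N] with v hv m hm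
    rw [dom_mul] at hm
    exact hm.elim (hu m) (hv m)

/-- The word with the single letter `a` at position `n`. -/
def singleton (a n : ℕ) : LWord := fun m => if m = n then some a else none

theorem dom_singleton (a n : ℕ) : dom (singleton a n) = {n} := by
  ext m
  change singleton a n m ≠ none ↔ m = n
  simp [singleton]

theorem singleton_apply_eq_some {a n m b : ℕ} (h : singleton a n m = some b) :
    m = n ∧ a = b := by
  simpa [singleton] using h

theorem escaping_nonempty_of_singleton {P : LWord → Prop} (a : ℕ)
    (h : ∀ n, P (singleton a n)) : (escaping P).Nonempty := by
  refine ⟨(hyperfilter ℕ).map (singleton a), ?_, fun N => ?_⟩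
  · rw [Ultrafilter.coe_map, eventually_map]
    exact Eventually.of_forall h
  · rw [Ultrafilter.coe_map, eventually_map]
    have : ∀ᶠ n in (hyperfilter ℕ : Filter ℕ), N < n :=
      Nat.hyperfilter_le_atTop (eventually_gt_atTop N)
    filter_upwards [this] with n hn m hm
    rw [dom_singleton, Set.mem_singleton_iff] at hm
    omega

/-- There are idempotent ultrafilters `ν` on constant words and `μ` on variable words such that
`μ ≤ ν` and all proper substitutions map `μ` to `ν`. -/
theorem exists_idempotent_pair {k : ℕ → ℕ} (hk : ∀ n, 0 < k n) :
    ∃ ν ∈ escaping (IsConstWord k), ∃ μ ∈ escaping (IsVarWord k),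
      ν * ν = ν ∧ μ * μ = μ ∧ μ * ν = μ ∧ ν * μ = μ ∧ ∀ p ≠ 0, μ.map (Tp k p) = ν := by
  obtain ⟨ν, hνC, hν, hmin⟩ := exists_minimal_idempotent Ultrafilter.continuous_mul_left
    (isClosed_escaping (IsConstWord k))
    (escaping_nonempty_of_singleton 1 fun n => ⟨by rw [dom_singleton]; exact Set.finite_singleton n,
      by rw [dom_singleton]; exact Set.singleton_nonempty n, fun m b h => by
        have := singleton_apply_eq_some h
        have := hk m
        omega⟩)
    (fun U hU V hV => mul_mem_escaping hU hV (fun _ hu => hu.1) fun _ _ hu hv _ => hu.mul hv)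
  obtain ⟨μ, hμV, hμ, hμν, hνμ⟩ := exists_idempotent_le Ultrafilter.continuous_mul_left
    (isClosed_escaping (IsVarWord k))
    (escaping_nonempty_of_singleton 0 fun n => ⟨by rw [dom_singleton]; exact Set.finite_singleton n,
      by rw [dom_singleton]; exact Set.singleton_nonempty n, fun m b h => by
        have := singleton_apply_eq_some h
        omega, n, by simp [singleton]⟩)
    (fun U hU V hV => mul_mem_escaping hU hV (fun _ hu => hu.1)
      fun _ _ hu hv _ => hu.mul_right hv.isWord) hν
    (fun U hU => mul_mem_escaping hνC hU (fun _ hu => hu.1)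
      fun _ _ hu hv huv => hv.mul_left hu.isWord huv)
    (fun U hU => mul_mem_escaping hU hνC (fun _ hu => hu.1)
      fun _ _ hu hv _ => hu.mul_right hv.isWord)
  refine ⟨ν, hνC, μ, hμV, hν, hμ, hμν, hνμ, fun p hp => ?_⟩
  have hTν : ν.map (Tp k p) = ν := by
    refine Ultrafilter.coe_inj.mp (Filter.ext' fun q => ?_)
    rw [Ultrafilter.coe_map, eventually_map]
    exact eventually_congr (hνC.1.mono fun w hw => by rw [Tp_of_isConstWord hw])
  refine hmin _ ⟨?_, fun N => ?_⟩ ?_ ?_ ?_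
  · rw [Ultrafilter.coe_map, eventually_map]
    exact hμV.1.mono fun w hw => hw.isConstWord_Tp hk hp
  · rw [Ultrafilter.coe_map, eventually_map]
    simpa only [dom_Tp] using hμV.2 N
  · rw [← Ultrafilter.map_mul_of_hom _ (Tp_mul p), hμ]
  · nth_rewrite 1 [← hTν]
    rw [← Ultrafilter.map_mul_of_hom _ (Tp_mul p), hμν]
  · nth_rewrite 1 [← hTν]
    rw [← Ultrafilter.map_mul_of_hom _ (Tp_mul p), hνμ]

theorem exists_fin_mem_of_eventually {X : Type*} {U : Ultrafilter X} {P : X → Prop}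
    (hP : ∀ᶠ x in U, P x) {r : ℕ} {A : Fin r → Set X} (hA : ∀ x, P x → ∃ i, x ∈ A i) :
    ∃ i, ∀ᶠ x in U, x ∈ A i := by
  by_contra! h
  obtain ⟨x, hx, hPx⟩ := ((eventually_all.2 h).and hP).exists
  obtain ⟨i, hi⟩ := hA x hPx
  exact hx i hi

theorem comb_eq_prod (k : ℕ → ℕ) (w : ℕ → LWord) {l : ℕ} (n p : Fin (l + 1) → ℕ) :
    comb k w n p = (List.ofFn fun i => Tp k (p i) (w (n i))).prod := rfl

theorem comb_succ (k : ℕ → ℕ) (w : ℕ → LWord) {l : ℕ} (n p : Fin (l + 1 + 1) → ℕ) :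
    comb k w n p = comb k w (fun i : Fin (l + 1) => n i.castSucc) (fun i => p i.castSucc) *
      Tp k (p (Fin.last _)) (w (n (Fin.last _))) := by
  rw [comb_eq_prod, List.ofFn_succ', List.concat_eq_append, List.prod_append, List.prod_singleton]
  rfl

theorem comb_zero (k : ℕ → ℕ) (w : ℕ → LWord) (n p : Fin (0 + 1) → ℕ) :
    comb k w n p = 1 * Tp k (p (Fin.last _)) (w (n (Fin.last _))) := by
  rw [comb_eq_prod, List.ofFn_succ', List.concat_eq_append, List.prod_append, List.prod_singleton]
  rfl

section Combinations

variable {k : ℕ → ℕ} {w : ℕ → LWord}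

theorem wlt_mul {u v x : LWord} (hu : wlt u x) (hv : wlt v x) : wlt (u * v) x := by
  intro m n hm hn
  have hm' : m ∈ dom (u * v) := hm
  rw [dom_mul] at hm'
  exact hm'.elim (fun h => hu m n h hn) fun h => hv m n h hn

theorem wlt_Tp {u x : LWord} (p : ℕ) (h : wlt u x) : wlt (Tp k p u) x := by
  intro m n hm hn
  have hm' : m ∈ dom (Tp k p u) := hm
  rw [dom_Tp] at hm'
  exact h m n hm' hn

theorem OrderlyVar.wlt_of_lt (hw : OrderlyVar k w) {m n : ℕ} (hmn : m < n) :
    wlt (w m) (w n) := by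
  induction n, hmn using Nat.le_induction with
  | base => exact hw.2 m
  | succ n _ ih =>
    intro a b ha hb
    obtain ⟨c, hc⟩ := (hw.1 n).2.1
    exact (ih a c ha hc).trans (hw.2 n c b hc hb)

theorem OrderlyVar.wlt_comb (hw : OrderlyVar k w) {m l : ℕ} (n p : Fin (l + 1) → ℕ)
    (h : ∀ i, n i < m) : wlt (comb k w n p) (w m) := by
  induction l with
  | zero =>
    rw [comb_zero, one_mul]
    exact wlt_Tp _ (hw.wlt_of_lt (h _))
  | succ l ih =>
    rw [comb_succ]
    exact wlt_mul (ih _ _ fun i => h _) (wlt_Tp _ (hw.wlt_of_lt (h _)))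

theorem OrderlyVar.isWord_comb (hk : ∀ n, 0 < k n) (hw : OrderlyVar k w) {l : ℕ}
    (n p : Fin (l + 1) → ℕ) : IsWord k (comb k w n p) := by
  induction l with
  | zero =>
    rw [comb_zero, one_mul]
    exact (hw.1 _).isWord_Tp hk _
  | succ l ih =>
    rw [comb_succ]
    exact (ih _ _).mul ((hw.1 _).isWord_Tp hk _)

theorem OrderlyVar.isConstWord_comb (hk : ∀ n, 0 < k n) (hw : OrderlyVar k w) {l : ℕ}
    (n p : Fin (l + 1) → ℕ) (hp : ∀ i, p i ≠ 0) : IsConstWord k (comb k w n p) := by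
  induction l with
  | zero =>
    rw [comb_zero, one_mul]
    exact (hw.1 _).isConstWord_Tp hk (hp _)
  | succ l ih =>
    rw [comb_succ]
    exact (ih _ _ fun i => hp _).mul ((hw.1 _).isConstWord_Tp hk (hp _))

theorem OrderlyVar.isVarWord_comb (hk : ∀ n, 0 < k n) (hw : OrderlyVar k w) {l : ℕ}
    (n p : Fin (l + 1) → ℕ) (hn : StrictMono n) (hp : ∃ i, p i = 0) :
    IsVarWord k (comb k w n p) := by
  induction l with
  | zero =>
    obtain ⟨i, hi⟩ := hp
    rw [comb_zero, one_mul, ← (Fin.ext (by simp) : i = Fin.last 0), hi, Tp_zero]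
    exact hw.1 _
  | succ l ih =>
    rw [comb_succ]
    by_cases hlast : p (Fin.last _) = 0
    · rw [hlast, Tp_zero]
      exact (hw.1 _).mul_left (hw.isWord_comb hk _ _)
        (hw.wlt_comb _ _ fun i => hn (Fin.castSucc_lt_last i))
    · obtain ⟨i, hi⟩ := hp
      refine (ih _ _ (hn.comp Fin.strictMono_castSucc) ?_).mul_right ((hw.1 _).isWord_Tp hk _)
      induction i using Fin.lastCases with
      | last => exact absurd hi hlast
      | cast i => exact ⟨i, hi⟩

end Combinations

/-- A sequence can be chosen greedily: if every `x ∈ G` can be prolonged, for `U`-most `w`, by all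
`Tp k p w` inside `G`, then some sequence of words has all its combinations in `G`. -/
theorem exists_seq_of_eventually {k : ℕ → ℕ} {μ : Ultrafilter LWord}
    (hμ : μ ∈ escaping (IsVarWord k)) {G : Set LWord} (h_one : 1 ∈ G)
    (hfin : ∀ x ∈ G, (dom x).Finite)
    (hG : ∀ x ∈ G, ∀ p, ∀ᶠ w in μ, x * Tp k p w ∈ G) :
    ∃ w : ℕ → LWord, OrderlyVar k w ∧ ∀ (l : ℕ) (n p : Fin (l + 1) → ℕ), StrictMono n →
      (∀ i, p i ≤ k (n i)) → comb k w n p ∈ G := by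
  let S := {F : Set LWord // F.Finite ∧ 1 ∈ F ∧ F ⊆ G}
  have step : ∀ (n : ℕ) (F : S), ∃ w, IsVarWord k w ∧
      ∀ x ∈ F.1, wlt x w ∧ ∀ p ∈ Set.Iic (k n), x * Tp k p w ∈ G := by
    intro n F
    have h : ∀ᶠ w in μ, ∀ x ∈ F.1, wlt x w ∧ ∀ p ∈ Set.Iic (k n), x * Tp k p w ∈ G :=
      (eventually_all_finite F.2.1).2 fun x hx =>
        (eventually_wlt hμ (hfin x (F.2.2.2 hx))).and <|
          (eventually_all_finite (Set.finite_Iic _)).2 fun p _ => hG x (F.2.2.2 hx) p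
    exact (hμ.1.and h).exists
  choose c hcvar hc using step
  let next : ℕ → S → S := fun n F =>
    ⟨F.1 ∪ Set.image2 (fun x p => x * Tp k p (c n F)) F.1 (Set.Iic (k n)),
      F.2.1.union (F.2.1.image2 _ (Set.finite_Iic _)), Or.inl F.2.2.1,
      Set.union_subset F.2.2.2 (by
        rintro _ ⟨x, hx, p, hp, rfl⟩
        exact (hc n F x hx).2 p hp)⟩
  let F : ℕ → S := fun n => Nat.rec ⟨{1}, Set.finite_singleton _, rfl, by simpa using h_one⟩ next n
  have hF : ∀ n, F (n + 1) = next n (F n) := fun n => rfl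
  have hmono : Monotone fun n => (F n).1 := monotone_nat_of_le_succ fun n => by
    rw [hF]
    exact Set.subset_union_left
  let w : ℕ → LWord := fun n => c n (F n)
  have hext : ∀ n, ∀ x ∈ (F n).1, ∀ p ≤ k n, x * Tp k p (w n) ∈ (F (n + 1)).1 := by
    intro n x hx p hp
    rw [hF]
    exact Or.inr ⟨x, hx, p, hp, rfl⟩
  refine ⟨w, ⟨fun n => hcvar n (F n), fun n => ?_⟩, ?_⟩
  · have := hext n 1 (F n).2.2.1 0 (Nat.zero_le _)
    rw [Tp_zero, one_mul] at this
    exact (hc (n + 1) (F (n + 1)) _ this).1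
  · have key : ∀ (l : ℕ) (n p : Fin (l + 1) → ℕ), StrictMono n → (∀ i, p i ≤ k (n i)) →
        ∃ x ∈ (F (n (Fin.last _))).1,
          comb k w n p = x * Tp k (p (Fin.last _)) (w (n (Fin.last _))) := by
      intro l
      induction l with
      | zero => exact fun n p _ _ => ⟨1, (F _).2.2.1, comb_zero k w n p⟩
      | succ l ih =>
        intro n p hn hp
        refine ⟨_, ?_, comb_succ k w n p⟩
        obtain ⟨x, hx, hcomb⟩ := ih (fun i => n i.castSucc) (fun i => p i.castSucc)
          (hn.comp (Fin.strictMono_castSucc)) fun i => hp _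
        rw [hcomb]
        exact hmono (Nat.succ_le_of_lt (hn (Fin.castSucc_lt_last _))) (hext _ x hx _ (hp _))
    intro l n p hn hp
    obtain ⟨x, hx, hcomb⟩ := key l n p hn hp
    rw [hcomb]
    exact (F (n (Fin.last l) + 1)).2.2.2 (hext _ x hx _ (hp _))

/-- **Partition theorem for ω-located words** (Theorem 1.1).
If `L(Σ,k⃗;υ) = A₁ ∪ ⋯ ∪ A_r` and `L(Σ,k⃗) = C₁ ∪ ⋯ ∪ C_s`, then there are an infinite
orderly sequence `(wₙ)` of variable ω-located words and indices `i₀, j₀` such that all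
combinations `T_{p₁}(w_{n₁}) ⋆ ⋯ ⋆ T_{p_λ}(w_{n_λ})` with some `pᵢ = 0` lie in `A_{i₀}`
and all such combinations with all `pᵢ ≥ 1` lie in `C_{j₀}`. -/
theorem partition_omega_located_words
    (k : ℕ → ℕ) (hk : ∀ n, 0 < k n) (r s : ℕ) (hr : 0 < r) (hs : 0 < s)
    (A : Fin r → Set LWord) (C : Fin s → Set LWord)
    (hA : ∀ w, IsVarWord k w → ∃ i, w ∈ A i)
    (hC : ∀ w, IsConstWord k w → ∃ j, w ∈ C j) :
    ∃ w : ℕ → LWord, OrderlyVar k w ∧ ∃ (i₀ : Fin r) (j₀ : Fin s),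
      (∀ (l : ℕ) (n p : Fin (l + 1) → ℕ), StrictMono n →
        (∀ i, p i ≤ k (n i)) → (∃ i, p i = 0) → comb k w n p ∈ A i₀) ∧
      (∀ (l : ℕ) (n p : Fin (l + 1) → ℕ), StrictMono n →
        (∀ i, 1 ≤ p i ∧ p i ≤ k (n i)) → comb k w n p ∈ C j₀) := by
  obtain ⟨ν, hνC, μ, hμV, hν, hμ, hμν, hνμ, hT⟩ := exists_idempotent_pair hk
  obtain ⟨i₀, hi₀⟩ := exists_fin_mem_of_eventually hμV.1 hA
  obtain ⟨j₀, hj₀⟩ := exists_fin_mem_of_eventually hνC.1 hC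
  let E : Set LWord := {x | IsVarWord k x ∧ x ∈ A i₀ ∨ IsConstWord k x ∧ x ∈ C j₀}
  let G : Set LWord :=
    {x | (x = 1 ∨ x ∈ E) ∧ (∀ᶠ y in ν, x * y ∈ E) ∧ ∀ᶠ y in μ, x * y ∈ E}
  have hGν : ∀ x ∈ G, ∀ᶠ y in ν, x * y ∈ G := by
    rintro x ⟨-, hxν, hxμ⟩
    have h₁ := hxν
    have h₂ := hxμ
    rw [← hν, Ultrafilter.eventually_mul] at h₁
    rw [← hνμ, Ultrafilter.eventually_mul] at h₂
    filter_upwards [hxν, h₁, h₂] with y hy hy₁ hy₂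
    simp only [← mul_assoc] at hy₁ hy₂
    exact ⟨Or.inr hy, hy₁, hy₂⟩
  have hGμ : ∀ x ∈ G, ∀ᶠ y in μ, x * y ∈ G := by
    rintro x ⟨-, hxν, hxμ⟩
    have h₁ := hxμ
    have h₂ := hxμ
    rw [← hμν, Ultrafilter.eventually_mul] at h₁
    rw [← hμ, Ultrafilter.eventually_mul] at h₂
    filter_upwards [hxμ, h₁, h₂] with y hy hy₁ hy₂
    simp only [← mul_assoc] at hy₁ hy₂
    exact ⟨Or.inr hy, hy₁, hy₂⟩
  have h_one : (1 : LWord) ∈ G := by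
    refine ⟨Or.inl rfl, ?_, ?_⟩
    · filter_upwards [hνC.1, hj₀] with y hy hyC
      rw [one_mul]
      exact Or.inr ⟨hy, hyC⟩
    · filter_upwards [hμV.1, hi₀] with y hy hyA
      rw [one_mul]
      exact Or.inl ⟨hy, hyA⟩
  have hfin : ∀ x ∈ G, (dom x).Finite := by
    rintro x ⟨rfl | hx | hx, -⟩
    · rw [dom_one]; exact Set.finite_empty
    · exact hx.1.1
    · exact hx.1.1
  obtain ⟨w, hw, hcomb⟩ := exists_seq_of_eventually hμV h_one hfin fun x hx p => by
    obtain rfl | hp := eq_or_ne p 0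
    · simpa only [Tp_zero] using hGμ x hx
    · have := hGν x hx
      rwa [← hT p hp, Ultrafilter.coe_map, eventually_map] at this
  refine ⟨w, hw, i₀, j₀, fun l n p hn hp hp₀ => ?_, fun l n p hn hp => ?_⟩
  · have hvar := hw.isVarWord_comb hk n p hn hp₀
    rcases (hcomb l n p hn hp).1 with h | h | h
    · have hne := hvar.2.1
      rw [h, dom_one] at hne
      exact absurd hne Set.not_nonempty_empty
    · exact h.2
    · exact absurd h.1 hvar.not_isConstWord
  · have hconst := hw.isConstWord_comb hk n p fun i => Nat.one_le_iff_ne_zero.1 (hp i).1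
    rcases (hcomb l n p hn fun i => (hp i).2).1 with h | h | h
    · have hne := hconst.2.1
      rw [h, dom_one] at hne
      exact absurd hne Set.not_nonempty_empty
    · exact absurd hconst h.1.not_isConstWord
    · exact h.2

end Farmaki
end

section
/- Let k⃗ = (kₙ)_{n∈ℕ} be an increasing sequence of positive integers and r, s ∈ ℕ. If W(Σ,k⃗;υ) = A₁ ∪ … ∪ A_r and W(Σ,k⃗) = C₁ ∪ … ∪ C_s, then there exist a sequence (uₙ)_{n∈ℕ} ∈ W^∞(Σ,k⃗;υ) and indices 1 ≤ i₀ ≤ r, 1 ≤ j₀ ≤ s such that: T_{p₁}(u_{n₁}) ⋆ … ⋆ T_{p_λ}(u_{n_λ}) ∈ A_{i₀} for every λ ∈ ℕ, n₁ < … < n_λ ∈ ℕ and p₁,…,p_λ ∈ ℕ ∪ {0} with 0 ≤ pᵢ ≤ k_{nᵢ} for every i and 0 ∈ {p₁,…,p_λ}; and T_{p₁}(u_{n₁}) ⋆ … ⋆ T_{p_λ}(u_{n_λ}) ∈ C_{j₀} for every λ ∈ ℕ, n₁ < … < n_λ ∈ ℕ and p₁,…,p_λ ∈ ℕ with 1 ≤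 pᵢ ≤ k_{nᵢ} for every i. -/
namespace Farmaki

/-- An ω-word is a list of letters; `0` is the variable `υ` and `a ≥ 1` is the
letter `αₐ`.  A variable ω-word dominated by `k`: nonempty, with the letter at
(0-based) position `i` at most `k i`, and containing the variable. -/
def WVar (k : ℕ → ℕ) (w : List ℕ) : Prop :=
  w ≠ [] ∧ (∀ (i : ℕ) (h : i < w.length), w.get ⟨i, h⟩ ≤ k i) ∧ 0 ∈ w

/-- A (constant) ω-word dominated by `k`. -/
def WConst (k : ℕ → ℕ) (w : List ℕ) : Prop :=
  w ≠ [] ∧ ∀ (i : ℕ) (h : i < w.length), 1 ≤ w.get ⟨i, h⟩ ∧ w.get ⟨i, h⟩ ≤ k i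

/-- `w < u` for ω-words: `w` is shorter and `u` starts with `|w|` letters `α₁`. -/
def wltW (w u : List ℕ) : Prop :=
  w.length < u.length ∧ ∀ (i : ℕ) (h : i < u.length), i < w.length → u.get ⟨i, h⟩ = 1

/-- Concatenation `w ⋆ u` of ω-words with `w < u`. -/
def starW (w u : List ℕ) : List ℕ := w ++ u.drop w.length

/-- The substitution `T_p` on ω-words. -/
def TpW (k : ℕ → ℕ) (p : ℕ) (w : List ℕ) : List ℕ :=
  w.mapIdx fun i a => if a = 0 ∧ p ≠ 0 then min p (k i) else a

/-- The combination `T_{p 0}(w (n 0)) ⋆ ⋯ ⋆ T_{p l}(w (n l))` of ω-words. -/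
def combW (k : ℕ → ℕ) (w : ℕ → List ℕ) {l : ℕ} (n p : Fin (l + 1) → ℕ) : List ℕ :=
  (List.ofFn fun i => TpW k (p i) (w (n i))).foldr starW []

/-- A member of `W^∞(Σ,k⃗;υ)`: an orderly infinite sequence of variable ω-words. -/
def WOrderly (k : ℕ → ℕ) (w : ℕ → List ℕ) : Prop :=
  (∀ n, WVar k (w n)) ∧ ∀ n, wltW (w n) (w (n + 1))

end Farmaki

namespace Farmaki

/-- A nonempty compact right topological semigroup `S` contains an idempotent that is minimal
for the order `e ≤ c ↔ e * c = e ∧ c * e = e`. -/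
theorem exists_minimal_idempotent_s3 {M : Type*} [Semigroup M] [TopologicalSpace M]
    [CompactSpace M] [T2Space M] (hcont : ∀ r : M, Continuous (· * r)) {S : Set M}
    (hS : IsClosed S) (hne : S.Nonempty) (hmul : ∀ x ∈ S, ∀ y ∈ S, x * y ∈ S) :
    ∃ c ∈ S, c * c = c ∧ ∀ e ∈ S, e * e = e → e * c = e → c * e = e → e = c := by
  let I : Set (Set M) :=
    {L | IsClosed L ∧ L.Nonempty ∧ L ⊆ S ∧ ∀ x ∈ S, ∀ y ∈ L, x * y ∈ L}
  obtain ⟨L, hLS, hL⟩ : ∃ L, L ⊆ S ∧ Minimal (· ∈ I) L := by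
    refine zorn_superset_nonempty I (fun c hcI hc hcne => ?_) S ⟨hS, hne, subset_rfl, hmul⟩
    refine ⟨⋂₀ c, ⟨isClosed_sInter fun t ht => (hcI ht).1, ?_, ?_, ?_⟩,
      fun s hs => Set.sInter_subset_of_mem hs⟩
    · have := hcne.to_subtype
      exact IsCompact.nonempty_sInter_of_directed_nonempty_isCompact_isClosed
        (IsChain.directedOn hc.symm) (fun t ht => (hcI ht).2.1)
        (fun t ht => (hcI ht).1.isCompact) (fun t ht => (hcI ht).1)
    · obtain ⟨t, ht⟩ := hcne
      exact (Set.sInter_subset_of_mem ht).trans (hcI ht).2.2.1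
    · exact fun x hx y hy t ht => (hcI ht).2.2.2 x hx y (hy t ht)
  obtain ⟨hLc, hLne, -, hLmul⟩ := hL.prop
  obtain ⟨c, hcL, hcc⟩ := exists_idempotent_in_compact_subsemigroup hcont L hLne hLc.isCompact
    fun x hx y hy => hLmul x (hLS hx) y hy
  refine ⟨c, hLS hcL, hcc, fun e he hee hec hce => ?_⟩
  have heL : e ∈ L := hec ▸ hLmul e he c hcL
  have himage : (· * e) '' S = L := by
    refine hL.eq_of_subset ⟨(hcont e).isClosedMap _ hS, hne.image _, ?_, ?_⟩ ?_
    · rintro _ ⟨x, hx, rfl⟩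
      exact hmul x hx e he
    · rintro x hx _ ⟨y, hy, rfl⟩
      exact ⟨x * y, hmul x hx y hy, mul_assoc x y e⟩
    · rintro _ ⟨x, hx, rfl⟩
      exact hLmul x hx e heL
  have hc : c ∈ (· * e) '' S := himage.symm ▸ hcL
  obtain ⟨x, -, hx : x * e = c⟩ := hc
  rw [← hx, mul_assoc, hee] at hce
  exact hce.symm.trans hx

/-- Below every idempotent `c` there is an idempotent in any closed subsemigroup absorbing `c`. -/
theorem exists_idempotent_le_s3 {M : Type*} [Semigroup M] [TopologicalSpace M]
    [CompactSpace M] [T2Space M] (hcont : ∀ r : M, Continuous (· * r)) {V : Set M}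
    (hV : IsClosed V) (hne : V.Nonempty) (hmul : ∀ x ∈ V, ∀ y ∈ V, x * y ∈ V)
    {c : M} (hc : c * c = c) (hcV : ∀ x ∈ V, c * x ∈ V) (hVc : ∀ x ∈ V, x * c ∈ V) :
    ∃ v ∈ V, v * v = v ∧ c * v = v ∧ v * c = v := by
  obtain ⟨_, ⟨x, hx, rfl⟩, he⟩ := exists_idempotent_in_compact_subsemigroup hcont ((· * c) '' V)
    (hne.image _) ((hcont c).isClosedMap _ hV).isCompact (by
      rintro _ ⟨x, hx, rfl⟩ _ ⟨y, hy, rfl⟩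
      exact ⟨x * c * y, hmul _ (hVc x hx) y hy, by simp only [mul_assoc]⟩)
  have hxc : x * c * c = x * c := by rw [mul_assoc, hc]
  refine ⟨c * (x * c), hcV _ (hVc x hx), ?_, by rw [← mul_assoc, hc], by rw [mul_assoc, hxc]⟩
  calc c * (x * c) * (c * (x * c)) = c * ((x * c * c) * (x * c)) := by simp only [mul_assoc]
    _ = c * (x * c) := by rw [hxc]; exact congrArg (c * ·) he

theorem length_starW (w u : List ℕ) : (starW w u).length = max w.length u.length := by
  simp only [starW, List.length_append, List.length_drop]
  omega

theorem getElem_starW (w u : List ℕ) (i : ℕ) (h : i < (starW w u).length) :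
    (starW w u)[i] = if hw : i < w.length then w[i] else
      u[i]'(by rw [length_starW] at h; omega) := by
  unfold starW
  grind

theorem starW_assoc (w u v : List ℕ) : starW (starW w u) v = starW w (starW u v) := by
  apply List.ext_getElem
  · simp only [length_starW, max_assoc]
  · intro i h₁ h₂
    simp only [getElem_starW, length_starW]
    grind

/-- The operation `⋆` is associative on all lists. -/
abbrev starSemigroup : Semigroup (List ℕ) where
  mul := starW
  mul_assoc := starW_assoc

attribute [local instance] starSemigroup Ultrafilter.mul Ultrafilter.semigroup

theorem starW_nil_left (w : List ℕ) : starW [] w = w := rfl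

theorem starW_nil_right (w : List ℕ) : starW w [] = w := by simp [starW]

theorem mem_starW {a : ℕ} {w u : List ℕ} (h : a ∈ starW w u) : a ∈ w ∨ a ∈ u :=
  (List.mem_append.1 h).imp_right List.mem_of_mem_drop

theorem TpW_zero (k : ℕ → ℕ) (w : List ℕ) : TpW k 0 w = w := by
  apply List.ext_getElem <;> simp [TpW]

theorem TpW_starW (k : ℕ → ℕ) (p : ℕ) (w u : List ℕ) :
    TpW k p (starW w u) = starW (TpW k p w) (TpW k p u) := by
  apply List.ext_getElem
  · simp [TpW, length_starW]
  · intro i h₁ h₂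
    simp only [TpW, List.getElem_mapIdx, getElem_starW, List.length_mapIdx]
    split <;> rfl

theorem TpW_of_zero_notMem (k : ℕ → ℕ) (p : ℕ) {w : List ℕ} (h : 0 ∉ w) : TpW k p w = w := by
  apply List.ext_getElem
  · simp [TpW]
  · intro i h₁ h₂
    have : w[i] ≠ 0 := fun h0 => h (h0 ▸ List.getElem_mem h₂)
    simp [TpW, this]

theorem zero_notMem_TpW {k : ℕ → ℕ} (hk : ∀ n, 0 < k n) {p : ℕ} (hp : p ≠ 0) (w : List ℕ) :
    0 ∉ TpW k p w := by
  intro h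
  obtain ⟨i, hi, h0⟩ := List.mem_iff_getElem.1 h
  simp only [TpW, List.getElem_mapIdx] at h0
  have := hk i
  split_ifs at h0 <;> grind

/-- Words dominated by `k`, longer than `m`, whose first `m` letters are `α₁`. -/
def IsTail (k : ℕ → ℕ) (m : ℕ) (w : List ℕ) : Prop :=
  m < w.length ∧ ∀ (i : ℕ) (h : i < w.length), w[i] ≤ k i ∧ (i < m → w[i] = 1)

theorem IsTail.starW {k : ℕ → ℕ} {m m' : ℕ} {w u : List ℕ} (hw : IsTail k m w)
    (hu : IsTail k m' u) : IsTail k m (starW w u) := by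
  refine ⟨by rw [length_starW]; exact lt_max_of_lt_left hw.1, fun i h => ?_⟩
  rw [getElem_starW]
  split_ifs with hi
  · exact hw.2 i hi
  · rw [length_starW] at h
    exact ⟨(hu.2 i (by omega)).1, fun him => absurd (him.trans hw.1) hi⟩

theorem IsTail.TpW {k : ℕ → ℕ} {m p : ℕ} {w : List ℕ} (hw : IsTail k m w) :
    IsTail k m (TpW k p w) := by
  refine ⟨by simpa [Farmaki.TpW] using hw.1, fun i h => ?_⟩
  have := hw.2 i (by simpa [Farmaki.TpW] using h)
  simp only [Farmaki.TpW, List.getElem_mapIdx]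
  split_ifs <;> grind

theorem IsTail.zero_mem_starW_iff {k : ℕ → ℕ} {w u : List ℕ} (hu : IsTail k w.length u) :
    0 ∈ Farmaki.starW w u ↔ 0 ∈ w ∨ 0 ∈ u := by
  refine ⟨mem_starW, fun h => List.mem_append.2 (h.imp_right fun h0 => ?_)⟩
  obtain ⟨i, hi, h0⟩ := List.mem_iff_getElem.1 h0
  have := (hu.2 i hi).2
  exact List.mem_drop_iff_getElem.2 ⟨i - w.length, by grind, by grind⟩

theorem IsTail.wVar {k : ℕ → ℕ} {m : ℕ} {w : List ℕ} (hw : IsTail k m w) (h0 : 0 ∈ w) :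
    WVar k w :=
  ⟨List.ne_nil_of_mem h0, fun i h => (hw.2 i h).1, h0⟩

theorem IsTail.wConst {k : ℕ → ℕ} {m : ℕ} {w : List ℕ} (hw : IsTail k m w) (h0 : 0 ∉ w) :
    WConst k w :=
  ⟨List.ne_nil_of_length_pos (Nat.zero_lt_of_lt hw.1), fun i h =>
    ⟨Nat.pos_of_ne_zero fun h1 => h0 (h1 ▸ List.getElem_mem h), (hw.2 i h).1⟩⟩

/-- Ultrafilters concentrating on late words dominated by `k`. -/
def tailUltrafilters (k : ℕ → ℕ) : Set (Ultrafilter (List ℕ)) :=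
  {U | ∀ m, ∀ᶠ w in U, IsTail k m w}

/-- Ultrafilters concentrating on late variable words. -/
def varUltrafilters (k : ℕ → ℕ) : Set (Ultrafilter (List ℕ)) :=
  tailUltrafilters k ∩ {U | ∀ᶠ w in (U : Filter (List ℕ)), 0 ∈ w}

/-- Ultrafilters concentrating on late constant words. -/
def constUltrafilters (k : ℕ → ℕ) : Set (Ultrafilter (List ℕ)) :=
  tailUltrafilters k ∩ {U | ∀ᶠ w in (U : Filter (List ℕ)), 0 ∉ w}

theorem isClosed_tailUltrafilters (k : ℕ → ℕ) : IsClosed (tailUltrafilters k) := by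
  simp only [tailUltrafilters, Set.ofPred_forall]
  exact isClosed_iInter fun m => ultrafilter_isClosed_basic {w | IsTail k m w}

theorem isClosed_varUltrafilters (k : ℕ → ℕ) : IsClosed (varUltrafilters k) :=
  (isClosed_tailUltrafilters k).inter (ultrafilter_isClosed_basic {w | 0 ∈ w})

theorem isClosed_constUltrafilters (k : ℕ → ℕ) : IsClosed (constUltrafilters k) :=
  (isClosed_tailUltrafilters k).inter (ultrafilter_isClosed_basic {w | 0 ∉ w})

theorem mul_mem_tailUltrafilters {k : ℕ → ℕ} {U V : Ultrafilter (List ℕ)}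
    (hU : U ∈ tailUltrafilters k) (hV : V ∈ tailUltrafilters k) : U * V ∈ tailUltrafilters k := by
  intro m
  rw [Ultrafilter.eventually_mul]
  filter_upwards [hU m] with w hw
  filter_upwards [hV 0] with u hu
  exact hw.starW hu

theorem mul_mem_constUltrafilters {k : ℕ → ℕ} {U V : Ultrafilter (List ℕ)}
    (hU : U ∈ constUltrafilters k) (hV : V ∈ constUltrafilters k) :
    U * V ∈ constUltrafilters k := by
  refine ⟨mul_mem_tailUltrafilters hU.1 hV.1, (Ultrafilter.eventually_mul _ _ _).2 ?_⟩
  filter_upwards [hU.2] with w hw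
  filter_upwards [hV.2] with u hu
  exact fun h => (mem_starW h).elim hw hu

theorem mul_mem_varUltrafilters {k : ℕ → ℕ} {U V : Ultrafilter (List ℕ)}
    (hU : U ∈ tailUltrafilters k) (hV : V ∈ tailUltrafilters k)
    (h : U ∈ varUltrafilters k ∨ V ∈ varUltrafilters k) : U * V ∈ varUltrafilters k := by
  refine ⟨mul_mem_tailUltrafilters hU hV, (Ultrafilter.eventually_mul _ _ _).2 ?_⟩
  rcases h with h | h
  · filter_upwards [h.2] with w hw
    exact .of_forall fun u => List.mem_append_left _ hw
  · refine .of_forall fun w => ?_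
    filter_upwards [hV w.length, h.2] with u hu hu0
    exact hu.zero_mem_starW_iff.2 (.inr hu0)

theorem varUltrafilters_nonempty (k : ℕ → ℕ) (hk : ∀ n, 0 < k n) :
    (varUltrafilters k).Nonempty := by
  refine ⟨(Filter.hyperfilter ℕ).map fun n => List.replicate n 1 ++ [0], fun m => ?_, ?_⟩
  · rw [Ultrafilter.coe_map, Filter.eventually_map]
    filter_upwards [Nat.hyperfilter_le_atTop (Filter.eventually_ge_atTop m)] with n hn
    refine ⟨by simp; omega, fun i h => ?_⟩
    have := hk i
    grind
  · rw [Set.mem_ofPred_eq, Ultrafilter.coe_map, Filter.eventually_map]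
    exact .of_forall fun n => List.mem_append_right _ (List.mem_singleton_self 0)

theorem map_TpW_mul (k : ℕ → ℕ) (p : ℕ) (U V : Ultrafilter (List ℕ)) :
    (U * V).map (TpW k p) = U.map (TpW k p) * V.map (TpW k p) := by
  refine Ultrafilter.coe_inj.1 (Filter.ext' fun P => ?_)
  have hmul : ∀ w u : List ℕ, TpW k p (w * u) = TpW k p w * TpW k p u := TpW_starW k p
  simp only [Ultrafilter.coe_map, Filter.eventually_map, Ultrafilter.eventually_mul, hmul]

theorem map_TpW_mem_constUltrafilters {k : ℕ → ℕ} (hk : ∀ n, 0 < k n) {p : ℕ} (hp : p ≠ 0)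
    {U : Ultrafilter (List ℕ)} (hU : U ∈ tailUltrafilters k) :
    U.map (TpW k p) ∈ constUltrafilters k :=
  ⟨fun m => Filter.eventually_map.2 ((hU m).mono fun _ hw => hw.TpW),
    Filter.eventually_map.2 (.of_forall fun w => zero_notMem_TpW hk hp w)⟩

theorem map_TpW_of_mem_constUltrafilters {k : ℕ → ℕ} (p : ℕ) {U : Ultrafilter (List ℕ)}
    (hU : U ∈ constUltrafilters k) : U.map (TpW k p) = U := by
  refine Ultrafilter.coe_inj.1 ?_
  rw [Ultrafilter.coe_map]
  exact (Filter.map_congr (hU.2.mono fun w hw => TpW_of_zero_notMem k p hw)).trans Filter.map_id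

/-- There are idempotents `v ≤ c` of variable and constant words, with `T_p v = c` for `p ≥ 1`. -/
theorem exists_idempotent_ultrafilters {k : ℕ → ℕ} (hk : ∀ n, 0 < k n) :
    ∃ v ∈ varUltrafilters k, ∃ c ∈ constUltrafilters k,
      v * v = v ∧ c * c = c ∧ c * v = v ∧ v * c = v ∧ ∀ p ≠ 0, v.map (TpW k p) = c := by
  obtain ⟨v₀, hv₀⟩ := varUltrafilters_nonempty k hk
  obtain ⟨c, hc, hcc, hmin⟩ := exists_minimal_idempotent_s3 Ultrafilter.continuous_mul_left
    (isClosed_constUltrafilters k) ⟨_, map_TpW_mem_constUltrafilters hk one_ne_zero hv₀.1⟩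
    fun x hx y hy => mul_mem_constUltrafilters hx hy
  obtain ⟨v, hv, hvv, hcv, hvc⟩ := exists_idempotent_le_s3 Ultrafilter.continuous_mul_left
    (isClosed_varUltrafilters k) ⟨v₀, hv₀⟩
    (fun x hx y hy => mul_mem_varUltrafilters hx.1 hy.1 (.inl hx)) hcc
    (fun x hx => mul_mem_varUltrafilters hc.1 hx.1 (.inr hx))
    (fun x hx => mul_mem_varUltrafilters hx.1 hc.1 (.inl hx))
  refine ⟨v, hv, c, hc, hvv, hcc, hcv, hvc, fun p hp => ?_⟩
  have hTc : c.map (TpW k p) = c := map_TpW_of_mem_constUltrafilters p hc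
  refine hmin _ (map_TpW_mem_constUltrafilters hk hp hv.1) ?_ ?_ ?_
  · rw [← map_TpW_mul, hvv]
  · conv_lhs => rw [← hTc, ← map_TpW_mul, hvc]
  · conv_lhs => rw [← hTc, ← map_TpW_mul, hcv]

/-- If `P` holds for almost all variable and constant words, there is an orderly sequence along
which all combinations satisfy `P`. -/
theorem exists_wOrderly_forall_combW {k : ℕ → ℕ} (hk : ∀ n, 0 < k n)
    {v c : Ultrafilter (List ℕ)} (hv : v ∈ varUltrafilters k)
    (hvv : v * v = v) (hcc : c * c = c) (hcv : c * v = v) (hvc : v * c = v)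
    (hT : ∀ p ≠ 0, v.map (TpW k p) = c) {P : List ℕ → Prop}
    (hPv : ∀ᶠ w in v, P w) (hPc : ∀ᶠ w in c, P w) :
    ∃ u : ℕ → List ℕ, WOrderly k u ∧ ∀ (l : ℕ) (n p : Fin (l + 1) → ℕ), StrictMono n →
      (∀ i, p i ≤ k (n i)) →
      P (combW k u n p) ∧ (0 ∈ combW k u n p ↔ ∃ i, p i = 0) := by
  let Q : List ℕ → Prop := fun w => (∀ᶠ u in v, P (starW w u)) ∧ ∀ᶠ u in c, P (starW w u)
  have hQv : ∀ w, Q w → ∀ᶠ u in v, P (starW w u) ∧ Q (starW w u) := by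
    rintro w ⟨h₁, h₂⟩
    have h₃ := h₁
    have h₄ := h₁
    rw [← hvv, Ultrafilter.eventually_mul] at h₃
    rw [← hvc, Ultrafilter.eventually_mul] at h₄
    filter_upwards [h₁, h₃, h₄] with u h₁ h₃ h₄
    simp only [Q, starW_assoc]
    exact ⟨h₁, h₃, h₄⟩
  have hQc : ∀ w, Q w → ∀ᶠ u in c, P (starW w u) ∧ Q (starW w u) := by
    rintro w ⟨h₁, h₂⟩
    have h₃ := h₁
    have h₄ := h₂
    rw [← hcv, Ultrafilter.eventually_mul] at h₃
    rw [← hcc, Ultrafilter.eventually_mul] at h₄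
    filter_upwards [h₂, h₃, h₄] with u h₂ h₃ h₄
    simp only [Q, starW_assoc]
    exact ⟨h₂, h₃, h₄⟩
  have hQT : ∀ w, Q w → ∀ p, ∀ᶠ u in v, P (starW w (TpW k p u)) ∧ Q (starW w (TpW k p u)) := by
    intro w hw p
    by_cases hp : p = 0
    · simpa only [hp, TpW_zero] using hQv w hw
    · have := hQc w hw
      rwa [← hT p hp, Ultrafilter.coe_map, Filter.eventually_map] at this
  have hstep : ∀ (n m : ℕ) (F : {F : Finset (List ℕ) // ∀ w ∈ F, Q w}),
      ∃ u, IsTail k m u ∧ 0 ∈ u ∧ ∀ w ∈ F.1, ∀ p ∈ Finset.range (k n + 1),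
        (P (starW w (TpW k p u)) ∧ Q (starW w (TpW k p u))) ∧
        (0 ∈ starW w (TpW k p u) ↔ 0 ∈ w ∨ p = 0) := by
    rintro n m ⟨F, hF⟩
    refine Filter.Eventually.exists (f := (v : Filter (List ℕ)))
      ((hv.1 m).and (hv.2.and ?_))
    refine (Filter.eventually_all_finset F).2 fun w hw =>
      (Filter.eventually_all_finset _).2 fun p _ => (hQT w (hF w hw) p).and ?_
    filter_upwards [hv.1 w.length, hv.2] with u hu hu0
    rw [(hu.TpW (p := p)).zero_mem_starW_iff]
    by_cases hp : p = 0
    · simp [hp, TpW_zero, hu0]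
    · simp [hp, zero_notMem_TpW hk hp u]
  choose g hgT hg0 hg using hstep
  let next (n m : ℕ) (F : {F : Finset (List ℕ) // ∀ w ∈ F, Q w}) :
      {F : Finset (List ℕ) // ∀ w ∈ F, Q w} :=
    ⟨F.1 ∪ (F.1 ×ˢ Finset.range (k n + 1)).image fun x => starW x.1 (TpW k x.2 (g n m F)), by
      intro w hw
      rcases Finset.mem_union.1 hw with hw | hw
      · exact F.2 w hw
      · obtain ⟨x, hx, rfl⟩ := Finset.mem_image.1 hw
        obtain ⟨hx₁, hx₂⟩ := Finset.mem_product.1 hx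
        exact (hg n m F x.1 hx₁ x.2 hx₂).1.2⟩
  let state : ℕ → ℕ × {F : Finset (List ℕ) // ∀ w ∈ F, Q w} := fun n =>
    n.rec (0, ⟨{[]}, by simpa [Q, starW_nil_left] using ⟨hPv, hPc⟩⟩)
      fun n σ => ((g n σ.1 σ.2).length, next n σ.1 σ.2)
  let u : ℕ → List ℕ := fun n => g n (state n).1 (state n).2
  let F : ℕ → Finset (List ℕ) := fun n => (state n).2.1
  have hF0 : [] ∈ F 0 := Finset.mem_singleton_self _
  have hFmono : Monotone F := monotone_nat_of_le_succ fun n => Finset.subset_union_left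
  have hFstep : ∀ n, ∀ w ∈ F n, ∀ p ≤ k n, starW w (TpW k p (u n)) ∈ F (n + 1) ∧
      P (starW w (TpW k p (u n))) ∧ (0 ∈ starW w (TpW k p (u n)) ↔ 0 ∈ w ∨ p = 0) := by
    intro n w hw p hp
    have hp' : p ∈ Finset.range (k n + 1) := Finset.mem_range_succ_iff.2 hp
    have := hg n (state n).1 (state n).2 w hw p hp'
    exact ⟨Finset.mem_union_right _ (Finset.mem_image.2
      ⟨(w, p), Finset.mem_product.2 ⟨hw, hp'⟩, rfl⟩), this.1.1, this.2⟩
  have hcomb : ∀ (l : ℕ) (n p : Fin (l + 1) → ℕ), StrictMono n → (∀ i, p i ≤ k (n i)) →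
      ∀ w ∈ F (n 0), P (starW w (combW k u n p)) ∧
        (0 ∈ starW w (combW k u n p) ↔ 0 ∈ w ∨ ∃ i, p i = 0) := by
    intro l
    induction l with
    | zero =>
      intro n p _ hp w hw
      simpa [combW, starW_nil_right, Fin.exists_fin_one] using (hFstep _ w hw _ (hp 0)).2
    | succ l ih =>
      intro n p hn hp w hw
      have hsucc : combW k u n p =
          starW (TpW k (p 0) (u (n 0))) (combW k u (n ∘ Fin.succ) (p ∘ Fin.succ)) := by
        simp only [combW]
        rw [List.ofFn_succ]
        rfl
      obtain ⟨hmem, -, h0⟩ := hFstep _ w hw _ (hp 0)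
      have := ih (n ∘ Fin.succ) (p ∘ Fin.succ) (hn.comp (Fin.strictMono_succ))
        (fun i => hp i.succ) _ (hFmono (Nat.succ_le_of_lt (hn (Fin.succ_pos 0))) hmem)
      rw [hsucc, ← starW_assoc, Fin.exists_fin_succ]
      refine ⟨this.1, this.2.trans ?_⟩
      rw [h0, or_assoc]
      rfl
  refine ⟨u, ⟨fun n => (hgT n _ _).wVar (hg0 n _ _), fun n => ?_⟩, fun l n p hn hp => ?_⟩
  · have := hgT (n + 1) (state (n + 1)).1 (state (n + 1)).2
    exact ⟨this.1, fun i h => (this.2 i h).2⟩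
  · simpa [starW_nil_left] using hcomb l n p hn hp [] (hFmono (Nat.zero_le _) hF0)

/-- **Theorem 1.4** (Partition theorem for ω-words). If `W(Σ,k⃗;υ) = A₁ ∪ ⋯ ∪ A_r` and
`W(Σ,k⃗) = C₁ ∪ ⋯ ∪ C_s`, there are `(uₙ) ∈ W^∞(Σ,k⃗;υ)` and indices `i₀, j₀` such that
every combination `T_{p₁}(u_{n₁}) ⋆ ⋯ ⋆ T_{p_λ}(u_{n_λ})` with some `pᵢ = 0` lies in
`A_{i₀}` and every such combination with all `pᵢ ≥ 1` lies in `C_{j₀}`. -/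
theorem partition_omega_words
    (k : ℕ → ℕ) (hk : ∀ n, 0 < k n) (hmono : Monotone k)
    (r s : ℕ) (hr : 0 < r) (hs : 0 < s)
    (A : Fin r → Set (List ℕ)) (C : Fin s → Set (List ℕ))
    (hA : ∀ w, WVar k w → ∃ i, w ∈ A i)
    (hC : ∀ w, WConst k w → ∃ j, w ∈ C j) :
    ∃ u : ℕ → List ℕ, WOrderly k u ∧ ∃ (i₀ : Fin r) (j₀ : Fin s),
      (∀ (l : ℕ) (n p : Fin (l + 1) → ℕ), StrictMono n →
        (∀ i, p i ≤ k (n i)) → (∃ i, p i = 0) → combW k u n p ∈ A i₀) ∧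
      (∀ (l : ℕ) (n p : Fin (l + 1) → ℕ), StrictMono n →
        (∀ i, 1 ≤ p i ∧ p i ≤ k (n i)) → combW k u n p ∈ C j₀) := by
  obtain ⟨v, hv, c, hc, hvv, hcc, hcv, hvc, hT⟩ := exists_idempotent_ultrafilters hk
  obtain ⟨i₀, hi₀⟩ : ∃ i, ∀ᶠ w in v, w ∈ A i := by
    refine Ultrafilter.eventually_exists_iff.1 ?_
    filter_upwards [hv.1 0, hv.2] with w hw h0 using hA w (hw.wVar h0)
  obtain ⟨j₀, hj₀⟩ : ∃ j, ∀ᶠ w in c, w ∈ C j := by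
    refine Ultrafilter.eventually_exists_iff.1 ?_
    filter_upwards [hc.1 0, hc.2] with w hw h0 using hC w (hw.wConst h0)
  obtain ⟨u, hu, hcomb⟩ := exists_wOrderly_forall_combW hk hv hvv hcc hcv hvc hT
    (P := fun w => (0 ∈ w → w ∈ A i₀) ∧ (0 ∉ w → w ∈ C j₀))
    (by filter_upwards [hi₀, hv.2] with w hw h0 using ⟨fun _ => hw, fun h => absurd h0 h⟩)
    (by filter_upwards [hj₀, hc.2] with w hw h0 using ⟨fun h => absurd h h0, fun _ => hw⟩)
  refine ⟨u, hu, i₀, j₀, fun l n p hn hp h0 => ?_, fun l n p hn hp => ?_⟩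
  · have := hcomb l n p hn hp
    exact this.1.1 (this.2.2 h0)
  · have := hcomb l n p hn fun i => (hp i).2
    refine this.1.2 fun h => ?_
    obtain ⟨i, hi⟩ := this.2.1 h
    exact absurd (hp i).1 (by omega)

end Farmaki
end

section
/- Let (X,+) be a commutative semigroup, k⃗ = (kₙ)_{n∈ℕ} an increasing sequence of positive integers, and for every l ∈ ℕ let (y_{l,n})_{n∈ℕ} be a sequence in X. If X = A₁ ∪ … ∪ A_r with r ∈ ℕ, then there exist 1 ≤ i₀ ≤ r, sequences (Eₙ)_{n∈ℕ} and (Hₙ)_{n∈ℕ} of nonempty finite subsets of ℕ with max Eₙ < min Eₙ₊₁ and Hₙ ⊆ Eₙ for every n ∈ ℕ, and a sequence (βₙ)_{n∈ℕ} in X with βₙ = Σ_{j∈Eₙ∖Hₙ} y_{lⁿⱼ,j} for some choices 1 ≤ lⁿⱼ ≤ kⱼ, such that for every function f : ℕ → ℕ with f(n) ≤ kₙ for every n ∈ ℕ one has FS((βₙ + Σ_{t∈Hₙ} y_{f(n),t})_{n∈ℕ}) ⊆ A_{i₀}. -/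
namespace Farmaki

variable {X : Type*}

/-- The sum of a nonempty list in a semigroup (junk value on the empty list). -/
noncomputable def listSum1 [AddSemigroup X] [Nonempty X] (l : List X) : X :=
  match l with
  | [] => Classical.arbitrary X
  | a :: t => t.foldl (· + ·) a

/-- The sum `Σ_{j ∈ E} g j` over a nonempty finite set in a commutative semigroup
(junk value on the empty set). -/
noncomputable def finsetSum1 [AddCommSemigroup X] [Nonempty X] (g : ℕ → X) (E : Finset ℕ) : X :=
  listSum1 ((E.sort (· ≤ ·)).map g)

/-- `FS((xₙ)ₙ)`: all finite sums `x_{n₁} + ⋯ + x_{n_λ}` with `n₁ < ⋯ < n_λ`. -/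
noncomputable def FSset [AddSemigroup X] [Nonempty X] (x : ℕ → X) : Set X :=
  {y | ∃ F : List ℕ, F ≠ [] ∧ F.Chain' (· < ·) ∧ y = listSum1 (F.map x)}

/-- `[FS((xₙ)ₙ)]^ω`: all sequences `(yₙ)` with `yₙ ∈ FS((xₙ)ₙ)` and `yₙ < yₙ₊₁`,
i.e. admitting representations by successive blocks of indices. -/
noncomputable def FSseq [AddSemigroup X] [Nonempty X] (x : ℕ → X) : Set (ℕ → X) :=
  {z | ∃ F : ℕ → List ℕ, (∀ n, F n ≠ []) ∧ (∀ n, (F n).Chain' (· < ·)) ∧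
    (∀ n, ∀ a ∈ F n, ∀ b ∈ F (n + 1), a < b) ∧
    ∀ n, z n = listSum1 ((F n).map x)}

end Farmaki

namespace Farmaki

section MinimalIdempotents

variable {G : Type*} [AddSemigroup G] [TopologicalSpace G] [T2Space G]

/-- A compact subsemigroup of a semigroup with continuous right translations contains an
idempotent which is minimal for the order `e ≤ p ↔ e + p = e ∧ p + e = e`. -/
theorem exists_minimal_idempotent_s4 (hcont : ∀ r : G, Continuous (· + r)) {S : Set G}
    (hne : S.Nonempty) (hS : IsCompact S) (hadd : ∀ a ∈ S, ∀ b ∈ S, a + b ∈ S) :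
    ∃ p ∈ S, p + p = p ∧ ∀ e ∈ S, e + e = e → e + p = e → p + e = e → e = p := by
  let I : Set (Set G) :=
    {L | L ⊆ S ∧ IsClosed L ∧ L.Nonempty ∧ ∀ a ∈ S, ∀ b ∈ L, a + b ∈ L}
  obtain ⟨L, hL⟩ : ∃ L, Minimal (· ∈ I) L := by
    refine (zorn_superset_nonempty I ?_ S ⟨subset_rfl, hS.isClosed, hne, hadd⟩).imp
      fun L h => h.2
    intro c hc hchain hcne
    have : Nonempty c := hcne.coe_sort
    refine ⟨⋂₀ c, ⟨?_, isClosed_sInter fun t ht => (hc ht).2.1, ?_, ?_⟩,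
      fun s hs => Set.sInter_subset_of_mem hs⟩
    · obtain ⟨t, ht⟩ := hcne
      exact (Set.sInter_subset_of_mem ht).trans (hc ht).1
    · exact IsCompact.nonempty_sInter_of_directed_nonempty_isCompact_isClosed
        (fun a ha b hb => (hchain.total ha hb).elim (fun h => ⟨a, ha, subset_rfl, h⟩)
          fun h => ⟨b, hb, h, subset_rfl⟩) (fun t ht => (hc ht).2.2.1)
        (fun t ht => hS.of_isClosed_subset (hc ht).2.1 (hc ht).1) (fun t ht => (hc ht).2.1)
    · exact fun a ha b hb t ht => (hc ht).2.2.2 a ha b (hb t ht)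
  obtain ⟨hLS, hLc, hLne, hLadd⟩ := hL.prop
  obtain ⟨p, hp, hpp⟩ := exists_idempotent_in_compact_add_subsemigroup hcont L hLne
    (hS.of_isClosed_subset hLc hLS) fun a ha b hb => hLadd a (hLS ha) b hb
  refine ⟨p, hLS hp, hpp, fun e he hee hep hpe => ?_⟩
  have heL : e ∈ L := hep ▸ hLadd e he p hp
  have himage : (· + e) '' L = L := by
    apply hL.eq_of_subset
    · refine ⟨?_, ?_, hLne.image _, ?_⟩
      · rintro _ ⟨b, hb, rfl⟩
        exact hadd b (hLS hb) e he
      · exact ((hS.of_isClosed_subset hLc hLS).image (hcont e)).isClosed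
      · rintro a ha _ ⟨b, hb, rfl⟩
        exact ⟨a + b, hLadd a ha b hb, add_assoc a b e⟩
    · rintro _ ⟨b, hb, rfl⟩
      exact hLadd b (hLS hb) e heL
  rw [← himage] at hp
  obtain ⟨b, -, rfl⟩ := hp
  simp only [add_assoc, hee] at hpe
  exact hpe.symm

/-- If `V` is a compact set absorbing a compact semigroup `S` from both sides, then below some
minimal idempotent of `S` there is an idempotent of `V`. -/
theorem exists_idempotent_le_minimal_idempotent (hcont : ∀ r : G, Continuous (· + r))
    {S V : Set G} (hSne : S.Nonempty) (hS : IsCompact S) (hSS : ∀ a ∈ S, ∀ b ∈ S, a + b ∈ S)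
    (hVne : V.Nonempty) (hV : IsCompact V) (hVV : ∀ a ∈ V, ∀ b ∈ V, a + b ∈ V)
    (hVS : ∀ a ∈ V, ∀ b ∈ S, a + b ∈ V) (hSV : ∀ a ∈ S, ∀ b ∈ V, a + b ∈ V) :
    ∃ p ∈ S, ∃ q ∈ V, p + p = p ∧ q + q = q ∧ p + q = q ∧ q + p = q ∧
      ∀ e ∈ S, e + e = e → e + p = e → p + e = e → e = p := by
  obtain ⟨p, hp, hpp, hmin⟩ := exists_minimal_idempotent_s4 hcont hSne hS hSS
  obtain ⟨_, ⟨v, hv, rfl⟩, hidem⟩ := exists_idempotent_in_compact_add_subsemigroup hcont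
    ((· + p) '' V) (hVne.image _) (hV.image (hcont p)) (by
      rintro _ ⟨a, ha, rfl⟩ _ ⟨b, hb, rfl⟩
      exact ⟨a + p + b, hVV _ (hVS a ha p hp) b hb, by simp only [add_assoc]⟩)
  have hvp : v + p + p = v + p := by rw [add_assoc, hpp]
  refine ⟨p, hp, p + (v + p), hSV p hp _ (hVS v hv p hp), hpp, ?_, ?_, ?_, hmin⟩
  · calc p + (v + p) + (p + (v + p)) = p + (v + p + p + (v + p)) := by simp only [add_assoc]
      _ = p + (v + p) := by rw [hvp]; exact congrArg (p + ·) hidem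
  · rw [← add_assoc, hpp]
  · rw [add_assoc, hvp]

end MinimalIdempotents

section Ultrafilters

attribute [local instance] Ultrafilter.add Ultrafilter.addSemigroup

theorem ultrafilter_map_add {M N : Type*} [Add M] [Add N] (T : M → N)
    (hT : ∀ a b, T (a + b) = T a + T b) (U V : Ultrafilter M) :
    (U + V).map T = U.map T + V.map T := by
  refine Ultrafilter.coe_inj.mp (Filter.ext' fun P => ?_)
  simp only [Ultrafilter.eventually_add, Ultrafilter.coe_map, Filter.eventually_map, hT]

/-- A word on finitely many places of `ℕ`; the letter `0` plays the role of the variable. -/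
def LocatedWord : Type := ℕ → Option ℕ

namespace LocatedWord

/-- Superposition of two words, the left one having priority. -/
instance : Add LocatedWord := ⟨fun u v j => (u j).or (v j)⟩

instance : Zero LocatedWord := ⟨fun _ => none⟩

instance : AddMonoid LocatedWord where
  add_assoc _ _ _ := funext fun _ => Option.or_assoc
  zero_add _ := funext fun _ => Option.none_or
  add_zero _ := funext fun _ => Option.or_none
  nsmul := nsmulRec

theorem add_apply (u v : LocatedWord) (j : ℕ) : (u + v) j = (u j).or (v j) := rfl

theorem zero_apply (j : ℕ) : (0 : LocatedWord) j = none := rfl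

/-- The word with the single letter `l`, at place `i`. -/
def single (i l : ℕ) : LocatedWord := fun j => if j = i then some l else none

theorem single_eq_some {i l j l' : ℕ} : single i l j = some l' ↔ j = i ∧ l = l' := by
  simp [single]

/-- Substitution of the letter `a` for the variable. -/
def subst (a : ℕ) (w : LocatedWord) : LocatedWord :=
  fun j => (w j).map fun l => if l = 0 then a else l

theorem subst_add (a : ℕ) (u v : LocatedWord) : subst a (u + v) = subst a u + subst a v := by
  funext j
  simp only [subst, add_apply]
  cases u j <;> simp

/-- The word has finitely many places, all beyond `m`, and the letter at place `j` is at most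
`k j`. -/
structure IsWord (k : ℕ → ℕ) (m : ℕ) (w : LocatedWord) : Prop where
  finite : {j | w j ≠ none}.Finite
  lt : ∀ j l, w j = some l → m < j
  le : ∀ j l, w j = some l → l ≤ k j

/-- A word without variable. -/
def IsConst (w : LocatedWord) : Prop := ∀ j, w j ≠ some 0

/-- A word in which the variable occurs. -/
def HasVar (w : LocatedWord) : Prop := ∃ j, w j = some 0

theorem IsWord.add {k : ℕ → ℕ} {m : ℕ} {u v : LocatedWord} (hu : IsWord k m u)
    (hv : IsWord k m v) : IsWord k m (u + v) := by
  refine ⟨(hu.finite.union hv.finite).subset fun j hj => ?_, fun j l hj => ?_, fun j l hj => ?_⟩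
  · by_contra h
    simp_all [add_apply]
  · rw [add_apply, Option.or_eq_some_iff] at hj
    exact hj.elim (hu.lt j l) fun h => hv.lt j l h.2
  · rw [add_apply, Option.or_eq_some_iff] at hj
    exact hj.elim (hu.le j l) fun h => hv.le j l h.2

theorem IsConst.add {u v : LocatedWord} (hu : IsConst u) (hv : IsConst v) :
    IsConst (u + v) := by
  intro j hj
  rw [add_apply, Option.or_eq_some_iff] at hj
  exact hj.elim (hu j) fun h => hv j h.2

theorem HasVar.add_right {u : LocatedWord} (hu : HasVar u) (v : LocatedWord) :
    HasVar (u + v) :=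
  hu.imp fun j hj => by simp [add_apply, hj]

theorem IsWord.exists_bound {k : ℕ → ℕ} {m : ℕ} {u : LocatedWord} (hu : IsWord k m u) :
    ∃ N, ∀ j l, u j = some l → j ≤ N := by
  obtain ⟨N, hN⟩ := hu.finite.bddAbove
  exact ⟨N, fun j l hj => hN (by simp [hj])⟩

theorem IsConst.subst_eq {w : LocatedWord} (hw : IsConst w) (a : ℕ) : subst a w = w := by
  funext j
  have := hw j
  simp only [subst]
  cases h : w j <;> simp_all

theorem isConst_subst {a : ℕ} (ha : a ≠ 0) (w : LocatedWord) : IsConst (subst a w) := by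
  intro j hj
  simp only [subst, Option.map_eq_some_iff] at hj
  obtain ⟨l, -, hl⟩ := hj
  split_ifs at hl with h
  exacts [ha hl, h hl]

theorem IsWord.subst {k : ℕ → ℕ} {m a : ℕ} {w : LocatedWord} (hw : IsWord k m w)
    (ha : ∀ j, m < j → a ≤ k j) : IsWord k m (subst a w) := by
  refine ⟨hw.finite.subset fun j hj h => hj (by simp [LocatedWord.subst, h]),
    fun j l hj => ?_, fun j l hj => ?_⟩ <;>
  · simp only [LocatedWord.subst, Option.map_eq_some_iff] at hj
    obtain ⟨l', hl', rfl⟩ := hj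
    first
      | exact hw.lt j l' hl'
      | split_ifs
        · exact ha j (hw.lt j l' hl')
        · exact hw.le j l' hl'

/-- Ultrafilters concentrating on words located arbitrarily far away with property `P`. -/
def remote (k : ℕ → ℕ) (P : LocatedWord → Prop) : Set (Ultrafilter LocatedWord) :=
  {U | ∀ m, ∀ᶠ w in U, IsWord k m w ∧ P w}

theorem isCompact_remote (k : ℕ → ℕ) (P : LocatedWord → Prop) : IsCompact (remote k P) := by
  refine IsClosed.isCompact ?_
  have : remote k P = ⋂ m, {U : Ultrafilter LocatedWord | {w | IsWord k m w ∧ P w} ∈ U} := by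
    ext U
    simp only [Set.mem_iInter]
    rfl
  rw [this]
  exact isClosed_iInter fun m => ultrafilter_isClosed_basic _

theorem remote_nonempty {k : ℕ → ℕ} {P : LocatedWord → Prop} (l : ℕ) (hl : ∀ j, l ≤ k j)
    (hP : ∀ i, P (single i l)) : (remote k P).Nonempty := by
  refine ⟨(Filter.hyperfilter ℕ).map fun i => single i l, fun m => ?_⟩
  rw [Ultrafilter.coe_map, Filter.eventually_map]
  have hm : ∀ᶠ i in (Filter.hyperfilter ℕ : Filter ℕ), m < i :=
    Nat.hyperfilter_le_atTop (Filter.eventually_gt_atTop m)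
  filter_upwards [hm] with i hi
  refine ⟨⟨(Set.finite_singleton i).subset fun j hj => ?_, fun j l' hj => ?_, fun j l' hj => ?_⟩,
    hP i⟩
  · by_contra h
    exact hj (if_neg h)
  · exact (single_eq_some.mp hj).1 ▸ hi
  · exact (single_eq_some.mp hj).2 ▸ hl j

theorem add_mem_remote {k : ℕ → ℕ} {P Q R : LocatedWord → Prop}
    (h : ∀ u v, IsWord k 0 u → P u → Q v → (∀ i j l l', u i = some l → v j = some l' → i < j) →
      R (u + v))
    {U V : Ultrafilter LocatedWord} (hU : U ∈ remote k P) (hV : V ∈ remote k Q) :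
    U + V ∈ remote k R := by
  intro m
  rw [Ultrafilter.eventually_add]
  filter_upwards [hU m, hU 0] with u hu hu0
  obtain ⟨N, hN⟩ := hu.1.exists_bound
  filter_upwards [hV m, hV N] with v hv hvN
  exact ⟨hu.1.add hv.1, h u v hu0.1 hu.2 hv.2 fun i j l l' hi hj =>
    (hN i l hi).trans_lt (hvN.1.lt j l' hj)⟩

theorem map_subst_mem_remote {k : ℕ → ℕ} (hmono : Monotone k) {a n : ℕ} (ha : a ≠ 0)
    (han : a ≤ k n) {P : LocatedWord → Prop} {U : Ultrafilter LocatedWord}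
    (hU : U ∈ remote k P) : U.map (subst a) ∈ remote k IsConst := by
  intro m
  rw [Ultrafilter.coe_map, Filter.eventually_map]
  filter_upwards [hU (max m n)] with w hw
  have hw' := hw.1.subst (a := a) fun j hj =>
    han.trans (hmono ((le_max_right m n).trans hj.le))
  exact ⟨⟨hw'.finite, fun j l hj => (le_max_left m n).trans_lt (hw'.lt j l hj), hw'.le⟩,
    isConst_subst ha w⟩

/-- There are an idempotent ultrafilter `p` and an ultrafilter `q` on remote variable words such
that every admissible substitution maps `q` to `p`. -/
theorem exists_idempotent_map_subst {k : ℕ → ℕ} (hk : ∀ n, 0 < k n) (hmono : Monotone k) :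
    ∃ p q : Ultrafilter LocatedWord, p + p = p ∧ q ∈ remote k HasVar ∧
      ∀ a n, a ≠ 0 → a ≤ k n → q.map (subst a) = p := by
  obtain ⟨p, hp, q, hq, hpp, hqq, hpq, hqp, hmin⟩ :=
    exists_idempotent_le_minimal_idempotent (G := Ultrafilter LocatedWord)
      Ultrafilter.continuous_add_left (S := remote k IsConst) (V := remote k HasVar)
      (remote_nonempty 1 hk fun i j h => one_ne_zero (single_eq_some.mp h).2)
      (isCompact_remote k _)
      (fun a ha b hb => add_mem_remote (fun u v _ hu hv _ => hu.add hv) ha hb)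
      (remote_nonempty 0 (fun j => Nat.zero_le _) fun i => ⟨i, single_eq_some.mpr ⟨rfl, rfl⟩⟩)
      (isCompact_remote k _)
      (fun a ha b hb => add_mem_remote (fun u v _ hu _ _ => hu.add_right v) ha hb)
      (fun a ha b hb => add_mem_remote (fun u v _ hu _ _ => hu.add_right v) ha hb)
      (fun a ha b hb => add_mem_remote (fun u v _ _ hv h => by
        obtain ⟨j, hj⟩ := hv
        refine ⟨j, ?_⟩
        cases hu : u j with
        | none => simp [add_apply, hu, hj]
        | some l => exact absurd (h j j l 0 hu hj) (lt_irrefl j)) ha hb)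
  refine ⟨p, q, hpp, hq, fun a n ha han => ?_⟩
  have hmap : p.map (subst a) = p := by
    refine Ultrafilter.coe_inj.mp ?_
    rw [Ultrafilter.coe_map]
    refine (Filter.map_congr ?_).trans Filter.map_id
    filter_upwards [hp 0] with w hw
    exact hw.2.subst_eq a
  refine hmin _ (map_subst_mem_remote hmono ha han hq) ?_ ?_ ?_
  · rw [← ultrafilter_map_add _ (subst_add a), hqq]
  · conv_lhs => rw [← hmap, ← ultrafilter_map_add _ (subst_add a), hqp]
  · conv_lhs => rw [← hmap, ← ultrafilter_map_add _ (subst_add a), hpq]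

/-- One step of the construction of the block sequence: a variable word beyond `m` whose
specializations with letters up to `n` lie in `C` and can be prolonged inside `C` by the elements
of some `D ∈ p`. -/
theorem exists_block {k : ℕ → ℕ} {p q : Ultrafilter LocatedWord} (hpp : p + p = p)
    (hq : q ∈ remote k HasVar) (n : ℕ)
    (hqp : ∀ a, a ≠ 0 → a ≤ n → q.map (subst a) = p) (C : {C : Set LocatedWord // C ∈ p})
    (m : ℕ) :
    ∃ (v : LocatedWord) (D : {D : Set LocatedWord // D ∈ p}), IsWord k m v ∧ HasVar v ∧
      D.1 ⊆ C.1 ∧ ∀ a, a ≠ 0 → a ≤ n → subst a v ∈ C.1 ∧ ∀ w ∈ D.1, subst a v + w ∈ C.1 := by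
  obtain ⟨C, hC⟩ := C
  have hC' : ∀ᶠ u in p, u ∈ C ∧ {w | u + w ∈ C} ∈ p := by
    refine Filter.Eventually.and hC ?_
    have : ∀ᶠ u in (p + p : Ultrafilter LocatedWord), u ∈ C := by rwa [hpp]
    exact (Ultrafilter.eventually_add p p (· ∈ C)).mp this
  have hsub : ∀ᶠ v in q, ∀ a ∈ Finset.Icc 1 n,
      subst a v ∈ C ∧ {w | subst a v + w ∈ C} ∈ p := by
    refine (Filter.eventually_all_finset _).mpr fun a ha => ?_
    rw [Finset.mem_Icc] at ha
    rw [← hqp a (Nat.one_le_iff_ne_zero.mp ha.1) ha.2, Ultrafilter.coe_map,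
      Filter.eventually_map] at hC'
    rwa [hqp a (Nat.one_le_iff_ne_zero.mp ha.1) ha.2] at hC'
  obtain ⟨v, hv, hword, hvar⟩ := (hsub.and (hq m)).exists
  refine ⟨v, ⟨C ∩ ⋂ a ∈ Finset.Icc 1 n, {w | subst a v + w ∈ C}, Filter.inter_mem hC
    ((Filter.biInter_finset_mem _).mpr fun a ha => (hv a ha).2)⟩, hword, hvar,
    Set.inter_subset_left, fun a ha han => ?_⟩
  have hmem : a ∈ Finset.Icc 1 n := Finset.mem_Icc.mpr ⟨Nat.one_le_iff_ne_zero.mpr ha, han⟩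
  exact ⟨(hv a hmem).1, fun w hw => Set.mem_iInter₂.mp hw.2 a hmem⟩

/-- For every finite cover of the located words there is a sequence of successive variable words
all of whose specializations, the `n`-th one with a letter at most `k n`, have their finite sums in
one member of the cover. -/
theorem exists_block_sequence {k : ℕ → ℕ} (hk : ∀ n, 0 < k n) (hmono : Monotone k)
    {ι : Type*} [Finite ι] (C : ι → Set LocatedWord) (hC : ∀ w, ∃ i, w ∈ C i) :
    ∃ (i : ι) (v : ℕ → LocatedWord), (∀ n, IsWord k 0 (v n) ∧ HasVar (v n)) ∧
      (∀ n n', n < n' → ∀ a b l l', v n a = some l → v n' b = some l' → a < b) ∧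
      ∀ f : ℕ → ℕ, (∀ n, f n ≠ 0 ∧ f n ≤ k n) → ∀ F : List ℕ, F ≠ [] →
        F.IsChain (· < ·) → (F.map fun n => subst (f n) (v n)).sum ∈ C i := by
  obtain ⟨p, q, hpp, hq, hqp⟩ := exists_idempotent_map_subst hk hmono
  obtain ⟨i, hi⟩ : ∃ i, ∀ᶠ w in p, w ∈ C i :=
    Ultrafilter.eventually_exists_iff.mp (Filter.Eventually.of_forall hC)
  have hstep : ∀ (n : ℕ) (s : {D : Set LocatedWord // D ∈ p} × ℕ),
      ∃ (v : LocatedWord) (t : {D : Set LocatedWord // D ∈ p} × ℕ),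
        (IsWord k s.2 v ∧ HasVar v) ∧ t.1.1 ⊆ s.1.1 ∧
        (∀ a, a ≠ 0 → a ≤ k n → subst a v ∈ s.1.1 ∧ ∀ w ∈ t.1.1, subst a v + w ∈ s.1.1) ∧
        s.2 ≤ t.2 ∧ ∀ j l, v j = some l → j ≤ t.2 := by
    intro n s
    obtain ⟨v, D, hword, hvar, hD, hsub⟩ :=
      exists_block hpp hq (k n) (fun a ha han => hqp a n ha han) s.1 s.2
    obtain ⟨N, hN⟩ := hword.exists_bound
    exact ⟨v, ⟨D, max s.2 N⟩, ⟨hword, hvar⟩, hD, hsub, le_max_left _ _,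
      fun j l hj => (hN j l hj).trans (le_max_right _ _)⟩
  choose v next hv hanti hsub hle hbound using hstep
  let s : ℕ → {D : Set LocatedWord // D ∈ p} × ℕ := fun n => Nat.rec (⟨C i, hi⟩, 0) next n
  have hs : Antitone fun n => (s n).1.1 := antitone_nat_of_succ_le fun n => hanti n (s n)
  have hm : Monotone fun n => (s n).2 := monotone_nat_of_le_succ fun n => hle n (s n)
  refine ⟨i, fun n => v n (s n), fun n => ⟨⟨(hv n (s n)).1.finite, fun j l hj =>
    (Nat.zero_le _).trans_lt ((hv n (s n)).1.lt j l hj), (hv n (s n)).1.le⟩, (hv n (s n)).2⟩,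
    fun n n' hn a b l l' ha hb => ?_, fun f hf F hF hchain => ?_⟩
  · calc a ≤ (s (n + 1)).2 := hbound n (s n) a l ha
      _ ≤ (s n').2 := hm hn
      _ < b := (hv n' (s n')).1.lt b l' hb
  · suffices h : ∀ (F : List ℕ) (n : ℕ), (n :: F).IsChain (· < ·) →
        ((n :: F).map fun n => subst (f n) (v n (s n))).sum ∈ (s n).1.1 by
      obtain ⟨n, F, rfl⟩ := List.exists_cons_of_ne_nil hF
      exact hs (Nat.zero_le n) (h F n hchain)
    intro F
    induction F with
    | nil =>
      intro n _
      simpa using (hsub n (s n) (f n) (hf n).1 (hf n).2).1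
    | cons n' F ih =>
      intro n hchain
      rw [List.isChain_cons_cons] at hchain
      rw [List.map_cons, List.sum_cons]
      exact (hsub n (s n) (f n) (hf n).1 (hf n).2).2 _
        (hs (Nat.succ_le_of_lt hchain.1) (ih n' hchain.2))

end LocatedWord

end Ultrafilters

section Sums

theorem coe_listSum1 {X : Type*} [AddCommSemigroup X] [Nonempty X] {l : List X} (hl : l ≠ []) :
    ((listSum1 l : X) : WithZero X) = (l.map ((↑) : X → WithZero X)).sum := by
  obtain ⟨a, t, rfl⟩ := List.exists_cons_of_ne_nil hl
  change ((t.foldl (· + ·) a : X) : WithZero X) = _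
  induction t generalizing a with
  | nil => simp
  | cons b t ih =>
    rw [List.foldl_cons, ih _ (by simp)]
    simp [add_assoc]

theorem coe_finsetSum1 {X : Type*} [AddCommSemigroup X] [Nonempty X] (g : ℕ → X) {E : Finset ℕ}
    (hE : E.Nonempty) : ((finsetSum1 g E : X) : WithZero X) = ∑ j ∈ E, (g j : WithZero X) := by
  rw [finsetSum1, coe_listSum1 (by simpa [← List.length_eq_zero_iff] using hE.ne_empty),
    List.map_map, Finset.sum, ← Multiset.sum_coe, ← Multiset.map_coe, Finset.sort_eq]
  rfl

namespace LocatedWord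

/-- The sum in `X` obtained by reading the letter `l` at place `j` as `y l j`. -/
noncomputable def value {X : Type*} [AddCommSemigroup X] (y : ℕ → ℕ → X) (w : LocatedWord) :
    WithZero X :=
  ∑ᶠ j, (w j).elim 0 fun l => (y l j : WithZero X)

variable {X : Type*} [AddCommSemigroup X] (y : ℕ → ℕ → X)

theorem value_zero : value y 0 = 0 := by
  simp [value, zero_apply]

theorem value_add {u v : LocatedWord} (hu : {j | u j ≠ none}.Finite)
    (hv : {j | v j ≠ none}.Finite) (h : ∀ j, u j = none ∨ v j = none) :
    value y (u + v) = value y u + value y v := by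
  have hfin : ∀ w : LocatedWord, {j | w j ≠ none}.Finite →
      (Function.support fun j => (w j).elim 0 fun l => (y l j : WithZero X)).Finite :=
    fun w hw => hw.subset fun j hj hnone => hj (by simp [hnone])
  rw [value, value, value, ← finsum_add_distrib (hfin u hu) (hfin v hv)]
  refine finsum_congr fun j => ?_
  rcases h j with h | h <;> simp [add_apply, h]

theorem sum_apply_eq_none {W : List LocatedWord} {j : ℕ} (h : ∀ u ∈ W, u j = none) :
    W.sum j = none := by
  induction W with
  | nil => rfl
  | cons u W ih =>
    rw [List.forall_mem_cons] at h
    simp [add_apply, h.1, ih h.2]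

theorem finite_sum {W : List LocatedWord} (h : ∀ w ∈ W, {j | w j ≠ none}.Finite) :
    {j | W.sum j ≠ none}.Finite := by
  refine (W.finite_toSet.biUnion h).subset fun j hj => ?_
  by_contra hnone
  refine hj (sum_apply_eq_none fun u hu => ?_)
  by_contra hne
  exact hnone (Set.mem_biUnion hu hne)

theorem value_sum {W : List LocatedWord} (hfin : ∀ w ∈ W, {j | w j ≠ none}.Finite)
    (hdisj : W.Pairwise fun u v => ∀ j, u j = none ∨ v j = none) :
    value y W.sum = (W.map (value y)).sum := by
  induction W with
  | nil => exact value_zero y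
  | cons u W ih =>
    rw [List.forall_mem_cons] at hfin
    rw [List.pairwise_cons] at hdisj
    rw [List.sum_cons, List.map_cons, List.sum_cons, ← ih hfin.2 hdisj.2]
    refine value_add y hfin.1 (finite_sum hfin.2) fun j => ?_
    by_cases hj : u j = none
    · exact .inl hj
    · exact .inr (sum_apply_eq_none fun w hw => (hdisj.1 w hw j).resolve_left hj)

theorem value_subst [Nonempty X] {w : LocatedWord} (hw : {j | w j ≠ none}.Finite)
    (hne : hw.toFinset.Nonempty) (a : ℕ) :
    value y (subst a w) =
      ((finsetSum1 (fun j => if w j = some 0 then y a j else y ((w j).getD 0) j) hw.toFinset : X) :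
        WithZero X) := by
  rw [coe_finsetSum1 _ hne, value, finsum_eq_sum_of_support_subset (s := hw.toFinset)]
  · refine Finset.sum_congr rfl fun j hj => ?_
    obtain ⟨l, hl⟩ := Option.ne_none_iff_exists'.mp (hw.mem_toFinset.mp hj)
    by_cases h0 : l = 0 <;> simp [subst, hl, h0]
  · intro j hj
    rw [hw.coe_toFinset]
    intro hnone
    exact hj (by simp [subst, hnone])

end LocatedWord

end Sums

/-- **Corollary 1.5** (van der Waerden / Hindman type theorem for commutative
semigroups). For every finite partition `X = A₁ ∪ ⋯ ∪ A_r` there exist an index `i₀`,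
successive nonempty finite sets `Eₙ` with nonempty `Hₙ ⊆ Eₙ`, and elements
`βₙ = Σ_{j ∈ Eₙ∖Hₙ} y_{lⁿⱼ,j}` (with `1 ≤ lⁿⱼ ≤ kⱼ`) such that for every `f : ℕ → ℕ`
with `1 ≤ f n ≤ kₙ` all finite sums of the sequence `(βₙ + Σ_{t ∈ Hₙ} y_{f n, t})ₙ`
lie in `A_{i₀}` (when `Eₙ∖Hₙ = ∅` the term is `Σ_{t ∈ Hₙ} y_{f n, t}`). -/
theorem commutative_semigroup_partition
    {X : Type*} [AddCommSemigroup X] [Nonempty X]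
    (k : ℕ → ℕ) (hk : ∀ n, 0 < k n) (hmono : Monotone k)
    (y : ℕ → ℕ → X)
    (r : ℕ) (hr : 0 < r) (A : Fin r → Set X) (hA : ∀ x : X, ∃ i, x ∈ A i) :
    ∃ (i₀ : Fin r) (E H : ℕ → Finset ℕ) (lc : ℕ → ℕ → ℕ) (β : ℕ → X),
      (∀ n, (E n).Nonempty) ∧ (∀ n, (H n).Nonempty) ∧ (∀ n, H n ⊆ E n) ∧
      (∀ n, ∀ a ∈ E n, ∀ b ∈ E (n + 1), a < b) ∧
      (∀ n, ∀ j ∈ E n \ H n, 1 ≤ lc n j ∧ lc n j ≤ k j) ∧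
      (∀ n, β n = finsetSum1 (fun j => y (lc n j) j) (E n \ H n)) ∧
      ∀ f : ℕ → ℕ, (∀ n, 1 ≤ f n ∧ f n ≤ k n) →
        FSset (fun n => finsetSum1
          (fun j => if j ∈ H n then y (f n) j else y (lc n j) j) (E n)) ⊆ A i₀ := by
  classical
  obtain ⟨i, v, hv, hlt, hsum⟩ := LocatedWord.exists_block_sequence hk hmono
    (fun i => {w : LocatedWord | ∀ x : X, w.value y = x → x ∈ A i}) (fun w => by
      by_cases hw : w.value y = 0
      · exact ⟨⟨0, hr⟩, fun x hx => absurd (hx.symm.trans hw) WithZero.coe_ne_zero⟩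
      · obtain ⟨x, hx⟩ := WithZero.ne_zero_iff_exists.mp hw
        obtain ⟨i, hi⟩ := hA x
        exact ⟨i, fun x' hx' => WithZero.coe_inj.mp (hx.trans hx') ▸ hi⟩)
  have hfin := fun n => (hv n).1.finite
  have hne : ∀ n, (hfin n).toFinset.Nonempty := fun n =>
    (hv n).2.imp fun j hj => (hfin n).mem_toFinset.mpr (by simp [hj])
  refine ⟨i, fun n => (hfin n).toFinset, fun n => {j ∈ (hfin n).toFinset | v n j = some 0},
    fun n j => (v n j).getD 0, _, hne, fun n => ?_, fun n => Finset.filter_subset _ _,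
    fun n a ha b hb => ?_, fun n j hj => ?_, fun n => rfl, ?_⟩
  · exact (hv n).2.imp fun j hj => by simp [hj]
  · obtain ⟨l, hl⟩ := Option.ne_none_iff_exists'.mp ((hfin n).mem_toFinset.mp ha)
    obtain ⟨l', hl'⟩ := Option.ne_none_iff_exists'.mp ((hfin (n + 1)).mem_toFinset.mp hb)
    exact hlt n (n + 1) n.lt_succ_self a b l l' hl hl'
  · rw [Finset.mem_sdiff, Finset.mem_filter, not_and] at hj
    obtain ⟨l, hl⟩ := Option.ne_none_iff_exists'.mp ((hfin n).mem_toFinset.mp hj.1)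
    have h0 := hj.2 hj.1
    rw [hl, Option.some_inj] at h0
    simp only [hl, Option.getD_some]
    exact ⟨Nat.one_le_iff_ne_zero.mpr h0, (hv n).1.le j l hl⟩
  · rintro f hf _ ⟨F, hF, hchain, rfl⟩
    refine hsum f (fun n => ⟨Nat.one_le_iff_ne_zero.mp (hf n).1, (hf n).2⟩) F hF hchain _ ?_
    have hnone : ∀ a n j, (v n).subst a j = none ↔ v n j = none := fun a n j => by
      simp [LocatedWord.subst]
    rw [LocatedWord.value_sum, coe_listSum1 (by simpa using hF), List.map_map, List.map_map]
    · refine congrArg List.sum (List.map_congr_left fun n _ => ?_)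
      refine (LocatedWord.value_subst y (hfin n) (hne n) (f n)).trans ?_
      simp only [Function.comp_apply]
      congr 3
      funext j
      by_cases h : v n j = some 0 <;> simp [h]
    · intro w hw
      obtain ⟨n, -, rfl⟩ := List.mem_map.mp hw
      simpa only [ne_eq, hnone] using hfin n
    · refine List.pairwise_map.mpr (hchain.pairwise.imp fun {n n'} hn j => ?_)
      rw [hnone, hnone]
      by_contra! h
      obtain ⟨l, hl⟩ := Option.ne_none_iff_exists'.mp h.1
      obtain ⟨l', hl'⟩ := Option.ne_none_iff_exists'.mp h.2
      exact lt_irrefl j (hlt n n' hn j j l l' hl hl')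

end Farmaki
end
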